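/- Let X, Y ⊂ ℝⁿ be compact convex sets with nonempty interior, and let μ and ν be Borel probability measures on X and Y respectively, each absolutely continuous with respect to Lebesgue measure with densities bounded above and bounded away from zero. Let s(x, y) = exp(−|x − y|²/2). For each N, choose points p₁, …, p_N ∈ X such that the empirical measures μ_N = (1/N) Σ δ_{p_i} converge weakly to μ, let π_N be the unique maximizer of the Nash functional F over Borel probability measures on {p₁, …, p_N} × Y with second marginal ν, and define the absolutely continuous measure β_N on Y by β_N(Z) = (1/N) Σ_{i=1}^N π_N({p_i} × Z)/π_N({p_i} × Y). Let β̂ be the unique maximizer of F̂(β) = −H_ν(β) − W²(μ, β) over Borel probability measures on Y. Then F̂(β_N) → F̂(β̂) and β_N converges weakly to β̂. -/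

import Mathlib

open MeasureTheory Classical

/-- The measure `ν_i(B) = π({p_i} × B)` describing player `i`'s allocation. -/
noncomputable def nuI {Y : Type*} [MeasurableSpace Y] {N : ℕ}
    (π : Measure (Fin N × Y)) (i : Fin N) : Measure Y :=
  (π.restrict ({i} ×ˢ (Set.univ : Set Y))).map Prod.snd

/-- The Nash functional `F(π) = ln N + (1/N) ∑ᵢ ln ∫ s(pᵢ,y) dνᵢ(y)`, equal to `⊥ = -∞`
if some of the integrals vanishes. -/
noncomputable def NashF {Y : Type*} [MeasurableSpace Y] {N : ℕ}
    (s : Fin N → Y → ℝ) (π : Measure (Fin N × Y)) : EReal :=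
  if ∀ i : Fin N, 0 < ∫ y, s i y ∂(nuI π i) then
    ((Real.log N + (1 / (N : ℝ)) * ∑ i : Fin N, Real.log (∫ y, s i y ∂(nuI π i)) : ℝ) : EReal)
  else ⊥

/-- The quadratic transport cost `W²(μ, β)`. -/
noncomputable def W2 {n : ℕ} (μ β : Measure (EuclideanSpace ℝ (Fin n))) : ℝ :=
  sInf {r : ℝ | ∃ π : Measure (EuclideanSpace ℝ (Fin n) × EuclideanSpace ℝ (Fin n)),
    IsProbabilityMeasure π ∧ π.map Prod.fst = μ ∧ π.map Prod.snd = β ∧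
    r = ∫ p, ‖p.1 - p.2‖ ^ 2 / 2 ∂π}

/-- The functional `F̂(β) = −H_ν(β) − W²(μ, β)`, equal to `⊥` unless `β ≪ ν` with
`ln(dβ/dν)` `β`-integrable. -/
noncomputable def Fhat {n : ℕ} (μ ν : Measure (EuclideanSpace ℝ (Fin n)))
    (β : Measure (EuclideanSpace ℝ (Fin n))) : EReal :=
  if β ≪ ν ∧ Integrable (fun y => Real.log ((β.rnDeriv ν y).toReal)) β
  then ((-(∫ y, Real.log ((β.rnDeriv ν y).toReal) ∂β) - W2 μ β : ℝ) : EReal)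
  else ⊥

section NashOptimality

variable {Y : Type*} [MeasurableSpace Y] {N : ℕ}

theorem sum_nuI (π : Measure (Fin N × Y)) : ∑ i, nuI π i = π.map Prod.snd := by
  ext B hB
  rw [Measure.finsetSum_apply, Measure.map_apply measurable_snd hB]
  have h : (Prod.snd ⁻¹' B : Set (Fin N × Y)) = ⋃ i, Prod.snd ⁻¹' B ∩ ({i} ×ˢ Set.univ) := by
    ext x; simp
  rw [h, measure_iUnion, tsum_fintype]
  · refine Finset.sum_congr rfl fun i _ => ?_
    rw [nuI, Measure.map_apply measurable_snd hB, Measure.restrict_apply (measurable_snd hB)]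
  · intro i j hij
    refine Set.disjoint_left.2 fun x hx hx' => hij ?_
    simp only [Set.mem_inter_iff, Set.mem_prod, Set.mem_singleton_iff] at hx hx'
    exact hx.2.1.symm.trans hx'.2.1
  · exact fun i => (measurable_snd hB).inter ((measurableSet_singleton i).prod .univ)

theorem nuI_univ (π : Measure (Fin N × Y)) (i : Fin N) :
    nuI π i Set.univ = π ({i} ×ˢ (Set.univ : Set Y)) := by
  rw [nuI, Measure.map_apply measurable_snd .univ]; simp

/-- The allocation in which player `i` receives the measure `m i`. -/
noncomputable def allocation (m : Fin N → Measure Y) : Measure (Fin N × Y) :=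
  ∑ i, (m i).map (Prod.mk i)

theorem nuI_allocation (m : Fin N → Measure Y) (i : Fin N) : nuI (allocation m) i = m i := by
  ext B hB
  have h1 : MeasurableSet (Prod.snd ⁻¹' B ∩ ({i} ×ˢ (Set.univ : Set Y))) :=
    (measurable_snd hB).inter ((measurableSet_singleton i).prod .univ)
  rw [nuI, Measure.map_apply measurable_snd hB, Measure.restrict_apply (measurable_snd hB),
    allocation, Measure.finsetSum_apply, Finset.sum_eq_single i]
  · rw [Measure.map_apply measurable_prodMk_left h1]
    congr 1; ext y; simp
  · intro j _ hj
    rw [Measure.map_apply measurable_prodMk_left h1]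
    convert measure_empty (μ := m j)
    ext y; simp [hj]
  · simp

theorem map_snd_allocation (m : Fin N → Measure Y) :
    (allocation m).map Prod.snd = ∑ i, m i := by
  rw [← sum_nuI]; simp [nuI_allocation]

theorem sum_le_zero_of_forall_sum_log_le {ι : Type*} [Fintype ι] {u w : ι → ℝ} (hu : ∀ i, 0 < u i)
    (hw : ∀ i, 0 ≤ w i)
    (h : ∀ t ∈ Set.Ioo (0 : ℝ) 1,
      ∑ i, Real.log ((1 - t) * u i + t * w i) ≤ ∑ i, Real.log (u i)) :
    ∑ i, (w i / u i - 1) ≤ 0 := by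
  set a : ι → ℝ := fun i => w i / u i - 1 with ha
  have ha1 : ∀ i, -1 ≤ a i := fun i => by
    have := div_nonneg (hw i) (hu i).le
    simp only [ha]; linarith
  have key : ∀ t ∈ Set.Ioo (0 : ℝ) 1, ∑ i, a i / (1 + t * a i) ≤ 0 := by
    intro t ht
    have hpos : ∀ i, 0 < 1 + t * a i := fun i => by
      have := ha1 i
      nlinarith [ht.1, ht.2]
    have h1 : ∀ i, t * (a i / (1 + t * a i)) ≤
        Real.log ((1 - t) * u i + t * w i) - Real.log (u i) := by
      intro i
      have e : (1 - t) * u i + t * w i = u i * (1 + t * a i) := by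
        simp only [ha]; field_simp [(hu i).ne']; ring
      rw [e, Real.log_mul (hu i).ne' (hpos i).ne']
      have h2 := Real.one_sub_inv_le_log_of_pos (hpos i)
      have h3 : t * (a i / (1 + t * a i)) = 1 - (1 + t * a i)⁻¹ := by
        field_simp [(hpos i).ne']; ring
      linarith
    have h4 : t * ∑ i, a i / (1 + t * a i) ≤ 0 := by
      rw [Finset.mul_sum]
      calc _ ≤ ∑ i, (Real.log ((1 - t) * u i + t * w i) - Real.log (u i)) :=
            Finset.sum_le_sum fun i _ => h1 i
        _ ≤ 0 := by rw [Finset.sum_sub_distrib]; linarith [h t ht]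
    by_contra! hc
    nlinarith [mul_pos ht.1 hc]
  have hlim : Filter.Tendsto (fun t : ℝ => ∑ i, a i / (1 + t * a i)) (nhdsWithin 0 (Set.Ioi 0))
      (nhds (∑ i, a i)) := by
    have : ContinuousAt (fun t : ℝ => ∑ i, a i / (1 + t * a i)) 0 := by
      refine tendsto_finsetSum _ fun i _ => ?_
      exact ContinuousAt.div (by fun_prop) (by fun_prop) (by simp)
    have h2 := this.tendsto
    simp only [zero_mul, add_zero, div_one] at h2
    exact h2.mono_left nhdsWithin_le_nhds
  refine le_of_tendsto hlim ?_
  filter_upwards [Ioo_mem_nhdsGT (zero_lt_one (α := ℝ))] with t ht using key t ht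

theorem exists_measurable_argmax (hN : 1 ≤ N) {r : Fin N → Y → ℝ} (hr : ∀ i, Measurable (r i)) :
    ∃ k : Y → Fin N, Measurable k ∧ ∀ i y, r i y ≤ r (k y) y := by
  let P : Y → ℕ → Prop := fun y m => ∃ h : m < N, ∀ j, r j y ≤ r ⟨m, h⟩ y
  have : Nonempty (Fin N) := ⟨⟨0, hN⟩⟩
  have hP : ∀ y, ∃ m, P y m := fun y => by
    obtain ⟨i, hi⟩ := Finite.exists_max (fun i => r i y)
    exact ⟨i, i.2, hi⟩
  have hm : Measurable fun y => Nat.find (hP y) := by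
    refine measurable_find hP fun m => ?_
    by_cases h : m < N
    · have : {y | P y m} = ⋂ j, {y | r j y ≤ r ⟨m, h⟩ y} := by
        ext y; simp [P, h]
      rw [this]
      exact MeasurableSet.iInter fun j => measurableSet_le (hr j) (hr _)
    · have : {y | P y m} = ∅ := by
        ext y; simp [P, h]
      rw [this]; exact .empty
  refine ⟨fun y => ⟨Nat.find (hP y), (Nat.find_spec (hP y)).1⟩, ?_, ?_⟩
  · refine measurable_to_countable' fun i => ?_
    convert hm (measurableSet_singleton i.1) using 1
    ext y; simp [Fin.ext_iff]
  · exact fun i y => (Nat.find_spec (hP y)).2 i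

theorem NashF_of_pos {s : Fin N → Y → ℝ} {π : Measure (Fin N × Y)}
    (h : ∀ i, 0 < ∫ y, s i y ∂(nuI π i)) :
    NashF s π = ((Real.log N + (1 / (N : ℝ)) * ∑ i, Real.log (∫ y, s i y ∂(nuI π i)) : ℝ) : EReal) :=
  if_pos h

theorem nash_first_order (hN : 1 ≤ N) (ν : Measure Y) [IsProbabilityMeasure ν]
    (s : Fin N → Y → ℝ) (hsm : ∀ i, Measurable (s i)) (hspos : ∀ i y, 0 < s i y)
    (hsle : ∀ i y, s i y ≤ 1) (π : Measure (Fin N × Y))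
    (hmarg : π.map Prod.snd = ν)
    (hmax : ∀ π' : Measure (Fin N × Y), IsProbabilityMeasure π' → π'.map Prod.snd = ν →
      NashF s π' ≤ NashF s π) :
    (∀ i, 0 < ∫ y, s i y ∂(nuI π i)) ∧ ∀ m : Fin N → Measure Y, ∑ i, m i = ν →
      ∑ i, (∫ y, s i y ∂(m i)) / (∫ y, s i y ∂(nuI π i)) ≤ N := by
  have hNpos : (0 : ℝ) < N := by exact_mod_cast hN
  have hcomp : ∀ m : Fin N → Measure Y, ∑ i, m i = ν → NashF s (allocation m) ≤ NashF s π := by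
    intro m hm
    have h := map_snd_allocation m
    refine hmax _ ⟨?_⟩ (h.trans hm)
    have := congrArg (fun μ : Measure Y => μ Set.univ) (h.trans hm)
    simpa [Measure.map_apply measurable_snd] using this
  have hfin : ∀ m : Fin N → Measure Y, ∑ i, m i = ν → ∀ i, IsFiniteMeasure (m i) := by
    intro m hm i
    refine ⟨lt_of_le_of_lt ?_ (measure_lt_top ν Set.univ)⟩
    rw [← hm, Measure.finsetSum_apply]
    exact Finset.single_le_sum (f := fun i => m i Set.univ) (fun _ _ => zero_le)
      (Finset.mem_univ i)
  have hint : ∀ (i : Fin N) (m : Measure Y) [IsFiniteMeasure m], Integrable (s i) m := by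
    intro i m _
    refine Integrable.of_bound (hsm i).aestronglyMeasurable 1 (.of_forall fun y => ?_)
    rw [Real.norm_of_nonneg (hspos i y).le]; exact hsle i y
  have hπsum : ∑ i, nuI π i = ν := (sum_nuI π).trans hmarg
  have hpos : ∀ i, 0 < ∫ y, s i y ∂(nuI π i) := by
    by_contra hc
    have hbot : NashF s π = ⊥ := if_neg hc
    have h := hcomp (fun _ => (N : ENNReal)⁻¹ • ν) (by
      rw [Finset.sum_const, Finset.card_univ, Fintype.card_fin, ← Nat.cast_smul_eq_nsmul ENNReal,
        smul_smul, ENNReal.mul_inv_cancel (by simpa using (by omega : N ≠ 0)) (by simp), one_smul])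
    rw [NashF_of_pos, hbot] at h
    · exact (EReal.bot_lt_coe _).not_ge h
    · intro i
      rw [nuI_allocation, integral_smul_measure]
      refine smul_pos (by simpa using Nat.pos_of_ne_zero (by omega)) ?_
      rw [integral_pos_iff_support_of_nonneg (fun y => (hspos i y).le) (hint i ν)]
      have : Function.support (s i) = Set.univ := by ext y; simp [(hspos i y).ne']
      rw [this]; simp
  refine ⟨hpos, fun m hm => ?_⟩
  have hmf := hfin m hm
  have hπf := hfin _ hπsum
  have h := sum_le_zero_of_forall_sum_log_le (w := fun i => ∫ y, s i y ∂(m i)) hpos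
    (fun i => integral_nonneg fun y => (hspos i y).le) ?_
  · rw [Finset.sum_sub_distrib] at h
    simpa using h
  intro t ht
  have h1 : ∀ i, ∫ y, s i y ∂(ENNReal.ofReal (1 - t) • nuI π i + ENNReal.ofReal t • m i) =
      (1 - t) * ∫ y, s i y ∂(nuI π i) + t * ∫ y, s i y ∂(m i) := by
    intro i
    rw [integral_add_measure ((hint i _).smul_measure (by simp)) ((hint i _).smul_measure (by simp)),
      integral_smul_measure, integral_smul_measure, ENNReal.toReal_ofReal (by linarith [ht.2]),
      ENNReal.toReal_ofReal ht.1.le, smul_eq_mul, smul_eq_mul]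
  have h2 := hcomp (fun i => ENNReal.ofReal (1 - t) • nuI π i + ENNReal.ofReal t • m i) (by
    rw [Finset.sum_add_distrib, ← Finset.smul_sum, ← Finset.smul_sum, hπsum, hm, ← add_smul,
      ← ENNReal.ofReal_add (by linarith [ht.2]) ht.1.le]
    simp)
  rw [NashF_of_pos hpos, NashF_of_pos] at h2
  · rw [EReal.coe_le_coe_iff] at h2
    simp only [nuI_allocation, h1] at h2
    have h3 := le_of_add_le_add_left h2
    exact le_of_mul_le_mul_left h3 (by positivity)
  · intro i
    rw [nuI_allocation, h1]
    have : 0 ≤ ∫ y, s i y ∂(m i) := integral_nonneg fun y => (hspos i y).le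
    have := hpos i
    have := ht.1
    have : 0 < 1 - t := by linarith [ht.2]
    positivity

theorem exists_price (hN : 1 ≤ N) (ν : Measure Y) [IsProbabilityMeasure ν]
    (s : Fin N → Y → ℝ) (hsm : ∀ i, Measurable (s i)) (hspos : ∀ i y, 0 < s i y)
    (hsle : ∀ i y, s i y ≤ 1) (π : Measure (Fin N × Y))
    (hmarg : π.map Prod.snd = ν)
    (hmax : ∀ π' : Measure (Fin N × Y), IsProbabilityMeasure π' → π'.map Prod.snd = ν →
      NashF s π' ≤ NashF s π) :
    ∃ u : Fin N → ℝ, (∀ i, u i = ∫ y, s i y ∂(nuI π i)) ∧ (∀ i, 0 < u i) ∧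
      ∃ v : Y → ℝ, Measurable v ∧ (∀ i y, s i y ≤ u i * v y) ∧
      (∀ y, ∃ i, s i y = u i * v y) ∧ (∀ i, ∀ᵐ y ∂(nuI π i), s i y = u i * v y) ∧
      ∫ y, v y ∂ν = N := by
  obtain ⟨hpos, hfo⟩ := nash_first_order hN ν s hsm hspos hsle π hmarg hmax
  set u : Fin N → ℝ := fun i => ∫ y, s i y ∂(nuI π i) with hu
  refine ⟨u, fun _ => rfl, hpos, ?_⟩
  obtain ⟨k, hk, hkmax⟩ := exists_measurable_argmax hN (r := fun i y => s i y / u i)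
    (fun i => (hsm i).div_const _)
  have hvm : Measurable fun y => s (k y) y / u (k y) :=
    (measurable_from_prod_countable_right (f := fun q : Fin N × Y => s q.1 q.2 / u q.1)
      fun i => (hsm i).div_const (u i)).comp (hk.prodMk measurable_id)
  set v : Y → ℝ := fun y => s (k y) y / u (k y) with hv
  have hvpos : ∀ y, 0 < v y := fun y => div_pos (hspos _ _) (hpos _)
  have hvb : ∀ y, v y ≤ ∑ i, 1 / u i := fun y =>
    (div_le_div_of_nonneg_right (hsle _ _) (hpos _).le).trans
      (Finset.single_le_sum (f := fun i => 1 / u i) (fun i _ => (one_div_pos.2 (hpos i)).le)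
        (Finset.mem_univ (k y)))
  have hvint : ∀ (m : Measure Y) [IsFiniteMeasure m], Integrable v m := fun m _ =>
    Integrable.of_bound hvm.aestronglyMeasurable (∑ i, 1 / u i) (.of_forall fun y => by
      rw [Real.norm_of_nonneg (hvpos y).le]; exact hvb y)
  have hπsum : ∑ i, nuI π i = ν := (sum_nuI π).trans hmarg
  have hfin : ∀ i, IsFiniteMeasure (nuI π i) := by
    intro i
    refine ⟨lt_of_le_of_lt ?_ (measure_lt_top ν Set.univ)⟩
    rw [← hπsum, Measure.finsetSum_apply]
    exact Finset.single_le_sum (f := fun i => nuI π i Set.univ) (fun _ _ => zero_le)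
      (Finset.mem_univ i)
  have hsint : ∀ i, Integrable (fun y => s i y / u i) (nuI π i) := fun i =>
    (Integrable.of_bound (hsm i).aestronglyMeasurable 1 (.of_forall fun y => by
      rw [Real.norm_of_nonneg (hspos i y).le]; exact hsle i y)).div_const _
  have hcell : ∀ i, MeasurableSet (k ⁻¹' {i}) := fun i => hk (measurableSet_singleton i)
  have hsumcell : ∑ i, ν.restrict (k ⁻¹' {i}) = ν := by
    rw [← Measure.sum_fintype, ← Measure.restrict_iUnion _ hcell]
    · have : ⋃ i, k ⁻¹' {i} = Set.univ := by ext; simp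
      rw [this, Measure.restrict_univ]
    · intro i j hij
      exact Disjoint.preimage _ (by simpa using hij)
  have hle : ∫ y, v y ∂ν ≤ N := by
    have h := hfo _ hsumcell
    refine le_trans (le_of_eq ?_) h
    conv_lhs => rw [← hsumcell]
    rw [integral_finsetSum_measure fun i _ => hvint _]
    refine Finset.sum_congr rfl fun i _ => ?_
    rw [← integral_div]
    refine setIntegral_congr_fun (hcell i) fun y hy => ?_
    simp only [Set.mem_preimage, Set.mem_singleton_iff] at hy
    simp [hv, hy, hu]
  have hparts : ∫ y, v y ∂ν = ∑ i, ∫ y, v y ∂(nuI π i) := by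
    conv_lhs => rw [← hπsum]
    exact integral_finsetSum_measure fun i _ => hvint _
  have hone : ∀ i, ∫ y, s i y / u i ∂(nuI π i) = 1 := fun i => by
    rw [integral_div]; exact div_self (hpos i).ne'
  have hge1 : ∀ i, 1 ≤ ∫ y, v y ∂(nuI π i) := fun i => by
    rw [← hone i]
    exact integral_mono (hsint i) (hvint _) fun y => hkmax i y
  have heq1 : ∀ i, ∫ y, v y ∂(nuI π i) = 1 := by
    intro i
    refine le_antisymm ?_ (hge1 i)
    by_contra! hc
    have : ∑ _i : Fin N, (1 : ℝ) < ∑ i, ∫ y, v y ∂(nuI π i) :=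
      Finset.sum_lt_sum (fun i _ => hge1 i) ⟨i, Finset.mem_univ i, hc⟩
    rw [← hparts] at this
    simp at this
    linarith
  refine ⟨v, hvm, ?_, ?_, ?_, ?_⟩
  · intro i y
    have := hkmax i y
    rwa [div_le_iff₀' (hpos i)] at this
  · intro y
    have hne : u (k y) ≠ 0 := (hpos (k y)).ne'
    exact ⟨k y, by simp only [hv]; field_simp⟩
  · intro i
    have h0 : ∫ y, (v y - s i y / u i) ∂(nuI π i) = 0 := by
      rw [integral_sub (hvint _) (hsint i), heq1, hone, sub_self]
    rw [integral_eq_zero_iff_of_nonneg (fun y => sub_nonneg.2 (hkmax i y))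
      ((hvint _).sub (hsint i))] at h0
    filter_upwards [h0] with y hy
    have hy' : v y - s i y / u i = 0 := hy
    have hne : u i ≠ 0 := (hpos i).ne'
    rw [sub_eq_zero.1 hy']; field_simp
  · rw [hparts]; simp [heq1]

end NashOptimality

section TransportWeights

/-- `w i` is the density with respect to `μ` of the mass transported to the point `p i`, in a
transport plan from `μ` to the empirical measure of `p` whose mean displacement is at most `δ`. -/
structure IsTransportWeights {E : Type*} [NormedAddCommGroup E] [MeasurableSpace E]
    (μ : Measure E) {N : ℕ} (p : Fin N → E) (δ : ℝ) (w : Fin N → E → ℝ) : Prop where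
  measurable : ∀ i, Measurable (w i)
  nonneg : ∀ i x, 0 ≤ w i x
  integral_eq_one : ∀ i, ∫ x, w i x ∂μ = 1
  sum_eq : ∀ᵐ x ∂μ, ∑ i, w i x = N
  cost_le : (1 / (N : ℝ)) * ∑ i, ∫ x, ‖x - p i‖ * w i x ∂μ ≤ δ

theorem exists_weights_of_subweights {E : Type*} [MeasurableSpace E] (μ : Measure E)
    [IsProbabilityMeasure μ] {N : ℕ} (hN : 1 ≤ N) (w₀ d : Fin N → E → ℝ)
    (hw₀ : ∀ i, Measurable (w₀ i)) (hw₀n : ∀ i x, 0 ≤ w₀ i x)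
    (hd : ∀ i, Measurable (d i)) (hdn : ∀ i x, 0 ≤ d i x) {D δ : ℝ}
    (hdD : ∀ i, ∀ᵐ x ∂μ, d i x ≤ D) (hdδ : ∀ i x, d i x * w₀ i x ≤ δ * w₀ i x) (hδ : 0 ≤ δ)
    (hrow : ∀ i, ∫ x, w₀ i x ∂μ ≤ 1) (hcol : ∀ x, ∑ i, w₀ i x ≤ N) :
    ∃ w : Fin N → E → ℝ, (∀ i, Measurable (w i)) ∧ (∀ i x, 0 ≤ w i x) ∧
      (∀ i, ∫ x, w i x ∂μ = 1) ∧ (∀ᵐ x ∂μ, ∑ i, w i x = N) ∧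
      (1 / (N : ℝ)) * ∑ i, ∫ x, d i x * w i x ∂μ ≤
        δ + D * (1 - (1 / (N : ℝ)) * ∑ i, ∫ x, w₀ i x ∂μ) := by
  have hNpos : (0 : ℝ) < N := by exact_mod_cast hN
  have hb : ∀ i x, w₀ i x ≤ N := fun i x =>
    (Finset.single_le_sum (f := fun i => w₀ i x) (fun i _ => hw₀n i x)
      (Finset.mem_univ i)).trans (hcol x)
  have hwint : ∀ i, Integrable (w₀ i) μ := fun i =>
    Integrable.of_bound (hw₀ i).aestronglyMeasurable N (.of_forall fun x => by
      rw [Real.norm_of_nonneg (hw₀n i x)]; exact hb i x)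
  set r : Fin N → ℝ := fun i => ∫ x, w₀ i x ∂μ with hr
  set c : E → ℝ := fun x => 1 - (1 / (N : ℝ)) * ∑ i, w₀ i x with hc
  have hcm : Measurable c := by
    refine measurable_const.sub (measurable_const.mul ?_)
    exact Finset.measurable_sum _ fun i _ => hw₀ i
  have hcn : ∀ x, 0 ≤ c x := fun x => by
    have : (1 / (N : ℝ)) * ∑ i, w₀ i x ≤ (1 / (N : ℝ)) * N := by gcongr; exact hcol x
    rw [one_div_mul_cancel hNpos.ne'] at this
    simp only [hc]; linarith
  have hc1 : ∀ x, c x ≤ 1 := fun x => by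
    have : 0 ≤ (1 / (N : ℝ)) * ∑ i, w₀ i x :=
      mul_nonneg (by positivity) (Finset.sum_nonneg fun i _ => hw₀n i x)
    simp only [hc]; linarith
  have hcint : Integrable c μ :=
    Integrable.of_bound hcm.aestronglyMeasurable 1 (.of_forall fun x => by
      rw [Real.norm_of_nonneg (hcn x)]; exact hc1 x)
  set θ : ℝ := 1 - (1 / (N : ℝ)) * ∑ i, r i with hθ
  have hcθ : ∫ x, c x ∂μ = θ := by
    simp only [hc, hθ, hr]
    rw [integral_sub (integrable_const _)
      ((integrable_finsetSum _ fun i _ => hwint i).const_mul _), integral_const_mul,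
      integral_finsetSum _ fun i _ => hwint i]
    simp
  have hθsum : (1 / (N : ℝ)) * ∑ i, (1 - r i) = θ := by
    rw [Finset.sum_sub_distrib, mul_sub]; simp [hθ, hNpos.ne']
  have hθn : 0 ≤ θ := by rw [← hcθ]; exact integral_nonneg hcn
  have hr1 : ∀ i, 0 ≤ 1 - r i := fun i => sub_nonneg.2 (hrow i)
  have hθr : ∀ i, (1 - r i) * (θ / θ) = 1 - r i := by
    intro i
    rcases eq_or_ne θ 0 with h0 | h0
    · have h1 : ∑ i, (1 - r i) = 0 := by
        rw [h0] at hθsum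
        rcases mul_eq_zero.1 hθsum with h | h
        · exact absurd h (by positivity)
        · exact h
      rw [(Finset.sum_eq_zero_iff_of_nonneg fun i _ => hr1 i).1 h1 i (Finset.mem_univ i), zero_mul]
    · rw [div_self h0, mul_one]
  have hθc : ∀ᵐ x ∂μ, θ * (c x / θ) = c x := by
    rcases eq_or_ne θ 0 with h0 | h0
    · rw [h0, integral_eq_zero_iff_of_nonneg hcn hcint] at hcθ
      filter_upwards [hcθ] with x hx
      simp only [Pi.zero_apply] at hx
      simp [hx]
    · exact .of_forall fun x => mul_div_cancel₀ _ h0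
  have hcor : ∀ i, Integrable (fun x => (1 - r i) * (c x / θ)) μ := fun i =>
    (hcint.div_const θ).const_mul _
  refine ⟨fun i x => w₀ i x + (1 - r i) * (c x / θ), fun i => ?_, fun i x => ?_, fun i => ?_, ?_, ?_⟩
  · exact (hw₀ i).add ((hcm.div_const θ).const_mul _)
  · exact add_nonneg (hw₀n i x) (mul_nonneg (hr1 i) (div_nonneg (hcn x) hθn))
  · rw [integral_add (hwint i) (hcor i), integral_const_mul, integral_div, hcθ, hθr]
    simp [hr]
  · filter_upwards [hθc] with x hx
    rw [Finset.sum_add_distrib, ← Finset.sum_mul]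
    have : ∑ i, (1 - r i) = N * θ := by rw [← hθsum]; field_simp
    rw [this, mul_assoc, hx]
    simp only [hc]; field_simp; ring
  · have hdint : ∀ i, Integrable (fun x => d i x * w₀ i x) μ := fun i =>
      ((hwint i).const_mul δ).mono' ((hd i).mul (hw₀ i)).aestronglyMeasurable
        (.of_forall fun x => by
          rw [Real.norm_of_nonneg (mul_nonneg (hdn i x) (hw₀n i x))]; exact hdδ i x)
    have hdle : ∀ i, ∀ᵐ x ∂μ, d i x * ((1 - r i) * (c x / θ)) ≤ D * ((1 - r i) * (c x / θ)) :=
      fun i => by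
        filter_upwards [hdD i] with x hx
        exact mul_le_mul_of_nonneg_right hx (mul_nonneg (hr1 i) (div_nonneg (hcn x) hθn))
    have hdint2 : ∀ i, Integrable (fun x => d i x * ((1 - r i) * (c x / θ))) μ := fun i => by
      refine ((hcor i).const_mul D).mono'
        ((hd i).mul ((hcm.div_const θ).const_mul _)).aestronglyMeasurable ?_
      filter_upwards [hdle i] with x hx
      rw [Real.norm_of_nonneg (mul_nonneg (hdn i x)
        (mul_nonneg (hr1 i) (div_nonneg (hcn x) hθn)))]
      exact hx
    have h1 : ∀ i, ∫ x, d i x * (w₀ i x + (1 - r i) * (c x / θ)) ∂μ ≤ δ + D * (1 - r i) := by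
      intro i
      simp only [mul_add]
      rw [integral_add (hdint i) (hdint2 i)]
      refine add_le_add ?_ ?_
      · calc _ ≤ ∫ x, δ * w₀ i x ∂μ := integral_mono (hdint i) ((hwint i).const_mul δ) (hdδ i)
          _ = δ * r i := by rw [integral_const_mul]
          _ ≤ δ := by nlinarith [hrow i]
      · calc _ ≤ ∫ x, D * ((1 - r i) * (c x / θ)) ∂μ :=
            integral_mono_ae (hdint2 i) ((hcor i).const_mul D) (hdle i)
          _ = D * (1 - r i) := by
            rw [integral_const_mul, integral_const_mul, integral_div, hcθ, hθr]
    calc _ ≤ (1 / (N : ℝ)) * ∑ i, (δ + D * (1 - r i)) := by gcongr with i; exact h1 i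
      _ = δ + D * ((1 / (N : ℝ)) * ∑ i, (1 - r i)) := by
        rw [Finset.sum_add_distrib, ← Finset.mul_sum]
        simp only [Finset.sum_const, Finset.card_univ, Fintype.card_fin, nsmul_eq_mul]
        field_simp
      _ = _ := by rw [hθsum]

theorem exists_transport_weights {E : Type*} [NormedAddCommGroup E] [MeasurableSpace E]
    [BorelSpace E] {X : Set E} (hX : IsCompact X) (μ : Measure E) [IsProbabilityMeasure μ]
    (hμX : μ Xᶜ = 0) (p : (N : ℕ) → Fin N → E) (hpX : ∀ N i, p N i ∈ X)
    (hp : ∀ f : BoundedContinuousFunction E ℝ, Filter.Tendsto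
      (fun N : ℕ => (1 / (N : ℝ)) * ∑ i, f (p N i)) Filter.atTop (nhds (∫ x, f x ∂μ)))
    {ε : ℝ} (hε : 0 < ε) :
    ∀ᶠ N in Filter.atTop, ∃ w, IsTransportWeights μ (p N) ε w := by
  obtain ⟨D, hD⟩ := hX.isBounded.exists_norm_le
  obtain ⟨T, -, hTfin, hTcov⟩ := hX.finite_cover_balls (e := ε / 4) (by positivity)
  have : Fintype T := hTfin.fintype
  obtain ⟨χ, hχ⟩ := PartitionOfUnity.exists_isSubordinate hX.isClosed
    (fun j : T => Metric.ball (j : E) (ε / 4)) (fun _ => Metric.isOpen_ball)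
    (by simpa [Set.iUnion_coe_set] using hTcov)
  have hχ1 : ∀ x ∈ X, ∑ j, χ j x = 1 := fun x hx => by
    rw [← finsum_eq_sum_of_fintype]; exact χ.sum_eq_one hx
  have hχle : ∀ x, ∑ j, χ j x ≤ 1 := fun x => by
    rw [← finsum_eq_sum_of_fintype]; exact χ.sum_le_one x
  have hχm : ∀ j, Measurable (χ j) := fun j => (χ j).continuous.measurable
  have hχn : ∀ j, (∀ x, ‖χ j x‖ ≤ 1) := fun j x => by
    rw [Real.norm_of_nonneg (χ.nonneg j x)]; exact χ.le_one j x
  have hχint : ∀ j, Integrable (χ j) μ := fun j =>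
    Integrable.of_bound (hχm j).aestronglyMeasurable 1 (.of_forall (hχn j))
  set m : T → ℝ := fun j => ∫ x, χ j x ∂μ with hm
  have hmn : ∀ j, 0 ≤ m j := fun j => integral_nonneg fun x => χ.nonneg j x
  set mN : ℕ → T → ℝ := fun N j => (1 / (N : ℝ)) * ∑ i, χ j (p N i) with hmN
  have hmNlim : ∀ j, Filter.Tendsto (fun N => mN N j) Filter.atTop (nhds (m j)) := fun j =>
    hp (BoundedContinuousFunction.ofNormedAddCommGroup (χ j) (χ j).continuous 1 (hχn j))
  have hμX' : ∀ᵐ x ∂μ, x ∈ X := by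
    rw [ae_iff]; exact hμX
  have hmsum : ∑ j, m j = 1 := by
    rw [← integral_finsetSum _ fun j _ => hχint j]
    rw [integral_congr_ae (g := fun _ => (1 : ℝ))]
    · simp
    · filter_upwards [hμX'] with x hx using hχ1 x hx
  set κ : ℕ → ℝ := fun N => ∑ j, |mN N j - m j| / m j with hκ
  have hκn : ∀ N, 0 ≤ κ N := fun N => Finset.sum_nonneg fun j _ => div_nonneg (abs_nonneg _) (hmn j)
  have hκlim : Filter.Tendsto κ Filter.atTop (nhds 0) := by
    have : Filter.Tendsto κ Filter.atTop (nhds (∑ j, |m j - m j| / m j)) :=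
      tendsto_finsetSum _ fun j _ => (((hmNlim j).sub tendsto_const_nhds).abs).div_const _
    simpa using this
  have hrlim : Filter.Tendsto (fun N => (1 + κ N)⁻¹) Filter.atTop (nhds 1) := by
    have := (hκlim.const_add 1).inv₀ (by norm_num)
    simpa using this
  have hmass : Filter.Tendsto (fun N => (1 + κ N)⁻¹ * ∑ j, mN N j * (m j / m j)) Filter.atTop
      (nhds 1) := by
    have h1 : Filter.Tendsto (fun N => ∑ j, mN N j * (m j / m j)) Filter.atTop
        (nhds (∑ j, m j * (m j / m j))) :=
      tendsto_finsetSum _ fun j _ => (hmNlim j).mul_const _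
    have h2 : ∑ j, m j * (m j / m j) = 1 := by
      rw [← hmsum]
      refine Finset.sum_congr rfl fun j _ => ?_
      rcases eq_or_ne (m j) 0 with h | h
      · simp [h]
      · rw [div_self h, mul_one]
    rw [h2] at h1
    simpa using hrlim.mul h1
  have hlim : Filter.Tendsto (fun N => ε / 2 + 2 * D * (1 - (1 + κ N)⁻¹ *
      ∑ j, mN N j * (m j / m j))) Filter.atTop (nhds (ε / 2)) := by
    have := ((hmass.const_sub 1).const_mul (2 * D)).const_add (ε / 2)
    simpa using this
  filter_upwards [hlim.eventually (gt_mem_nhds (half_lt_self hε)), Filter.eventually_ge_atTop 1]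
    with N hNε hN
  have hNpos : (0 : ℝ) < N := by exact_mod_cast hN
  have hrn : 0 ≤ (1 + κ N)⁻¹ := inv_nonneg.2 (by linarith [hκn N])
  have hr1 : (1 + κ N)⁻¹ ≤ 1 := inv_le_one_of_one_le₀ (by linarith [hκn N])
  have hw₀int : ∀ i, ∫ x, (1 + κ N)⁻¹ * ∑ j, χ j (p N i) * (χ j x / m j) ∂μ =
      (1 + κ N)⁻¹ * ∑ j, χ j (p N i) * (m j / m j) := by
    intro i
    rw [integral_const_mul, integral_finsetSum _ fun j _ =>
      ((hχint j).div_const _).const_mul _]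
    simp only [integral_const_mul, integral_div, hm]
  refine Exists.imp (fun w hw => ⟨hw.1, hw.2.1, hw.2.2.1, hw.2.2.2.1, hw.2.2.2.2.trans ?_⟩)
    (exists_weights_of_subweights μ hN
    (fun i x => (1 + κ N)⁻¹ * ∑ j, χ j (p N i) * (χ j x / m j)) (fun i x => ‖x - p N i‖)
    (D := 2 * D) (δ := ε / 2) ?_ ?_ ?_ ?_ ?_ ?_ (by positivity) ?_ ?_)
  · exact fun i => (Finset.measurable_sum _ fun j _ =>
      ((hχm j).div_const _).const_mul _).const_mul _
  · exact fun i x => mul_nonneg hrn (Finset.sum_nonneg fun j _ =>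
      mul_nonneg (χ.nonneg _ _) (div_nonneg (χ.nonneg _ _) (hmn j)))
  · exact fun i => (continuous_id.sub continuous_const).norm.measurable
  · exact fun i x => norm_nonneg _
  · intro i
    filter_upwards [hμX'] with x hx
    calc ‖x - p N i‖ ≤ ‖x‖ + ‖p N i‖ := norm_sub_le _ _
      _ ≤ 2 * D := by linarith [hD x hx, hD _ (hpX N i)]
  · intro i x
    simp only [Finset.mul_sum]
    refine Finset.sum_le_sum fun j _ => ?_
    by_cases hj : χ j (p N i) = 0 ∨ χ j x = 0
    · rcases hj with h | h <;> simp [h]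
    · push Not at hj
      have hp1 := hχ j (subset_tsupport _ (Function.mem_support.2 hj.1))
      have hx1 := hχ j (subset_tsupport _ (Function.mem_support.2 hj.2))
      rw [Metric.mem_ball] at hp1 hx1
      refine mul_le_mul_of_nonneg_right ?_ (mul_nonneg hrn
        (mul_nonneg (χ.nonneg _ _) (div_nonneg (χ.nonneg _ _) (hmn j))))
      rw [← dist_eq_norm]
      linarith [dist_triangle_right x (p N i) j]
  · intro i
    rw [hw₀int]
    have : ∑ j, χ j (p N i) * (m j / m j) ≤ 1 := by
      refine le_trans (Finset.sum_le_sum fun j _ => ?_) (hχle (p N i))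
      exact mul_le_of_le_one_right (χ.nonneg _ _) (div_self_le_one _)
    exact (mul_le_of_le_one_right hrn this).trans hr1
  · intro x
    have hj : ∀ j, mN N j * (χ j x / m j) ≤ (1 + κ N) * χ j x := by
      intro j
      rcases (hmn j).eq_or_lt with h | h
      · rw [← h, div_zero, mul_zero]
        exact mul_nonneg (by linarith [hκn N]) (χ.nonneg _ _)
      · have h6 : |mN N j - m j| / m j ≤ κ N :=
          Finset.single_le_sum (f := fun j => |mN N j - m j| / m j)
            (fun j _ => div_nonneg (abs_nonneg _) (hmn j)) (Finset.mem_univ j)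
        have h7 : mN N j / m j ≤ 1 + κ N := by
          rw [div_le_iff₀ h] at h6 ⊢
          linarith [le_abs_self (mN N j - m j)]
        calc mN N j * (χ j x / m j) = mN N j / m j * χ j x := by ring
          _ ≤ _ := mul_le_mul_of_nonneg_right h7 (χ.nonneg _ _)
    have e : ∑ i, (1 + κ N)⁻¹ * ∑ j, χ j (p N i) * (χ j x / m j) =
        N * ((1 + κ N)⁻¹ * ∑ j, mN N j * (χ j x / m j)) := by
      rw [← Finset.mul_sum, Finset.sum_comm]
      simp only [hmN, ← Finset.sum_mul]
      rw [mul_left_comm, Finset.mul_sum (s := Finset.univ) (a := (N : ℝ))]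
      congr 2 with j
      field_simp
    rw [e]
    refine mul_le_of_le_one_right hNpos.le ?_
    calc (1 + κ N)⁻¹ * ∑ j, mN N j * (χ j x / m j)
        ≤ (1 + κ N)⁻¹ * ∑ j, (1 + κ N) * χ j x :=
          mul_le_mul_of_nonneg_left (Finset.sum_le_sum fun j _ => hj j) hrn
      _ = ∑ j, χ j x := by
        rw [← Finset.mul_sum, inv_mul_cancel_left₀ (by linarith [hκn N])]
      _ ≤ 1 := hχle x
  · refine le_trans (le_of_eq ?_) hNε.le
    simp only [hw₀int]
    congr 3
    rw [← Finset.mul_sum, Finset.sum_comm]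
    simp only [hmN, ← Finset.sum_mul]
    rw [mul_left_comm, Finset.mul_sum]
    simp only [mul_assoc]

end TransportWeights

section Translation

variable {E : Type*} [NormedAddCommGroup E] [InnerProductSpace ℝ E] [FiniteDimensional ℝ E]
  [MeasurableSpace E] [BorelSpace E]

theorem tendsto_integral_abs_translate_sub {h : E → ℝ} (hh : Integrable h) :
    Filter.Tendsto (fun c : E => ∫ x, |h (c + x) - h x|) (nhds 0) (nhds 0) := by
  have hL : MemLp h 1 volume := memLp_one_iff_integrable.2 hh
  have : Fact ((1 : ENNReal) ≠ ⊤) := ⟨by simp⟩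
  have hcont : Continuous fun c : E => (DomAddAct.mk c +ᵥ hL.toLp h : Lp ℝ 1 (volume : Measure E)) :=
    (continuous_id.vadd continuous_const).comp DomAddAct.continuous_mk
  have h0 := (hcont.dist (continuous_const (y := hL.toLp h))).tendsto 0
  rw [DomAddAct.mk_zero, zero_vadd, dist_self] at h0
  refine h0.congr fun c => ?_
  rw [DomAddAct.mk_vadd_toLp, dist_eq_norm, ← MemLp.toLp_sub, L1.norm_eq_integral_norm]
  refine integral_congr_ae ?_
  filter_upwards [MemLp.coeFn_toLp
    ((hL.comp_measurePreserving (measurePreserving_vadd c volume)).sub hL)] with x hx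
  exact congrArg norm hx

theorem eventually_abs_integral_sub_translate_le (μ : Measure E) [IsFiniteMeasure μ]
    (hμ : μ ≪ volume) {ε : ℝ} (hε : 0 < ε) :
    ∀ᶠ c in nhds (0 : E), ∀ (g : E → ℝ) (C : ℝ), Measurable g → (∀ x, |g x| ≤ C) →
      |∫ x, g x ∂μ - ∫ x, g (x - c) ∂μ| ≤ C * ε := by
  set h : E → ℝ := fun x => (μ.rnDeriv volume x).toReal with hh
  have hint : Integrable h := Measure.integrable_toReal_rnDeriv
  filter_upwards [(tendsto_integral_abs_translate_sub hint).eventually (gt_mem_nhds hε)]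
    with c hc g C hg hgC
  have hC : 0 ≤ C := (abs_nonneg _).trans (hgC 0)
  have hintc : Integrable fun x => h (c + x) := hint.comp_add_left c
  have e1 : ∫ x, g x ∂μ = ∫ x, h x * g x := by
    rw [← integral_rnDeriv_smul hμ]; rfl
  have e2 : ∫ x, g (x - c) ∂μ = ∫ x, h (c + x) * g x := by
    rw [← integral_rnDeriv_smul hμ, ← integral_add_left_eq_self _ c]
    simp [hh]
  have i1 : Integrable fun x => h x * g x :=
    hint.mul_bdd hg.aestronglyMeasurable (.of_forall hgC)
  have i2 : Integrable fun x => h (c + x) * g x :=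
    hintc.mul_bdd hg.aestronglyMeasurable (.of_forall hgC)
  rw [e1, e2, ← integral_sub i1 i2]
  calc |∫ x, (h x * g x - h (c + x) * g x)| ≤ ∫ x, |h x * g x - h (c + x) * g x| :=
        abs_integral_le_integral_abs
    _ ≤ ∫ x, C * |h (c + x) - h x| := by
        refine integral_mono (i1.sub i2).abs ((hintc.sub hint).abs.const_mul C) fun x => ?_
        simp only [← sub_mul, abs_mul]
        rw [abs_sub_comm, mul_comm]
        exact mul_le_mul_of_nonneg_right (hgC x) (abs_nonneg _)
    _ ≤ C * ε := by
        rw [integral_const_mul]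
        exact mul_le_mul_of_nonneg_left hc.le hC

end Translation

section TransportWeightsBounds

variable {E : Type*} [NormedAddCommGroup E] [MeasurableSpace E] {μ : Measure E} {N : ℕ}
  {p : Fin N → E} {δ : ℝ} {w : Fin N → E → ℝ}

theorem IsTransportWeights.ae_le (hw : IsTransportWeights μ p δ w) :
    ∀ᵐ x ∂μ, ∀ i, w i x ≤ N := by
  filter_upwards [hw.sum_eq] with x hx i
  rw [← hx]
  exact Finset.single_le_sum (f := fun i => w i x) (fun i _ => hw.nonneg i x) (Finset.mem_univ i)

theorem IsTransportWeights.integrable [IsFiniteMeasure μ] (hw : IsTransportWeights μ p δ w)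
    (i : Fin N) : Integrable (w i) μ := by
  refine Integrable.of_bound (hw.measurable i).aestronglyMeasurable N ?_
  filter_upwards [hw.ae_le] with x hx
  rw [Real.norm_of_nonneg (hw.nonneg i x)]; exact hx i

theorem IsTransportWeights.integrable_norm_sub_mul [BorelSpace E] [IsFiniteMeasure μ]
    (hw : IsTransportWeights μ p δ w) {X : Set E} {R : ℝ} (hX : ∀ x ∈ X, ‖x‖ ≤ R)
    (hμX : μ Xᶜ = 0) (hp : ∀ i, p i ∈ X) (i : Fin N) :
    Integrable (fun x => ‖x - p i‖ * w i x) μ := by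
  have hμX' : ∀ᵐ x ∂μ, x ∈ X := by rw [ae_iff]; exact hμX
  refine ((hw.integrable i).const_mul (2 * R)).mono'
    ((continuous_id.sub continuous_const).norm.measurable.mul (hw.measurable i)).aestronglyMeasurable
    ?_
  filter_upwards [hμX'] with x hx
  rw [Real.norm_of_nonneg (mul_nonneg (norm_nonneg _) (hw.nonneg i x))]
  refine mul_le_mul_of_nonneg_right ?_ (hw.nonneg i x)
  calc ‖x - p i‖ ≤ ‖x‖ + ‖p i‖ := norm_sub_le _ _
    _ ≤ 2 * R := by linarith [hX x hx, hX _ (hp i)]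

theorem IsTransportWeights.average_le [BorelSpace E] [IsFiniteMeasure μ] (hN : 1 ≤ N)
    (hw : IsTransportWeights μ p δ w) {X : Set E} {R : ℝ} (hX : ∀ x ∈ X, ‖x‖ ≤ R)
    (hμX : μ Xᶜ = 0) (hp : ∀ i, p i ∈ X) {f : E → ℝ} (hf : Measurable f) {C L : ℝ}
    (hfC : ∀ x, |f x| ≤ C) (hL : 0 ≤ L) (hfL : ∀ x y, f y - f x ≤ L * ‖x - y‖) :
    (1 / (N : ℝ)) * ∑ i, f (p i) ≤ ∫ x, f x ∂μ + L * δ := by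
  have hNpos : (0 : ℝ) < N := by exact_mod_cast hN
  have hi := hw.integrable_norm_sub_mul hX hμX hp
  have hfw : ∀ i, Integrable (fun x => f x * w i x) μ := fun i => by
    simpa only [mul_comm] using (hw.integrable i).mul_bdd hf.aestronglyMeasurable (.of_forall hfC)
  have h1 : ∀ i, f (p i) ≤ ∫ x, f x * w i x ∂μ + L * ∫ x, ‖x - p i‖ * w i x ∂μ := by
    intro i
    calc f (p i) = ∫ x, f (p i) * w i x ∂μ := by
          rw [integral_const_mul, hw.integral_eq_one, mul_one]
      _ ≤ ∫ x, (f x * w i x + L * (‖x - p i‖ * w i x)) ∂μ := by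
          refine integral_mono ((hw.integrable i).const_mul _)
            ((hfw i).add ((hi i).const_mul L)) fun x => ?_
          dsimp only
          rw [← mul_assoc, ← add_mul]
          exact mul_le_mul_of_nonneg_right (by linarith [hfL x (p i)]) (hw.nonneg i x)
      _ = _ := by rw [integral_add (hfw i) ((hi i).const_mul L), integral_const_mul]
  have h2 : ∑ i, ∫ x, f x * w i x ∂μ = N * ∫ x, f x ∂μ := by
    rw [← integral_finsetSum _ fun i _ => hfw i, ← integral_const_mul]
    refine integral_congr_ae ?_
    filter_upwards [hw.sum_eq] with x hx
    rw [← Finset.mul_sum, hx, mul_comm]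
  calc (1 / (N : ℝ)) * ∑ i, f (p i)
      ≤ (1 / (N : ℝ)) * ∑ i, (∫ x, f x * w i x ∂μ + L * ∫ x, ‖x - p i‖ * w i x ∂μ) := by
        gcongr with i; exact h1 i
    _ = ∫ x, f x ∂μ + L * ((1 / (N : ℝ)) * ∑ i, ∫ x, ‖x - p i‖ * w i x ∂μ) := by
        rw [Finset.sum_add_distrib, h2, ← Finset.mul_sum]; field_simp
    _ ≤ _ := by gcongr; exact hw.cost_le

end TransportWeightsBounds

section CellDiameter

open scoped RealInnerProductSpace

theorem exists_lipschitz_potential {E : Type*} [NormedAddCommGroup E] [InnerProductSpace ℝ E]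
    {Y : Set E} (hYne : Y.Nonempty) {R : ℝ} (hY : ∀ y ∈ Y, ‖y‖ ≤ R) {ι : Type*} [Nonempty ι]
    (p : ι → E) (l : E → ℝ) (a : ι → ℝ) (C : ι → Set E) (hCY : ∀ i, C i ⊆ Y)
    (hle : ∀ i, ∀ y ∈ Y, ⟪p i, y⟫ - l y ≤ a i) (heq : ∀ i, ∀ y ∈ C i, ⟪p i, y⟫ - l y = a i) :
    ∃ ψ : E → ℝ, (∀ x x', ψ x - ψ x' ≤ R * ‖x - x'‖) ∧
      ∀ i, ∀ y ∈ C i, ∀ y' ∈ C i, ∀ e,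
        ⟪e, y - y'⟫ ≤ ψ (p i + e) + ψ (p i - e) - 2 * ψ (p i) := by
  have : Nonempty Y := hYne.to_subtype
  have hR : ∀ x, ∀ y ∈ Y, ⟪x, y⟫ ≤ R * ‖x‖ := fun x y hy =>
    (real_inner_le_norm x y).trans (by
      rw [mul_comm]; exact mul_le_mul_of_nonneg_right (hY y hy) (norm_nonneg _))
  have hbdd : ∀ x, BddAbove (Set.range fun y : Y => ⟪x, (y : E)⟫ - l y) := by
    intro x
    obtain ⟨i⟩ := ‹Nonempty ι›
    refine ⟨a i + R * ‖x - p i‖, ?_⟩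
    rintro _ ⟨y, rfl⟩
    have h1 := hle i y y.2
    have h2 := hR (x - p i) y y.2
    rw [inner_sub_left] at h2
    dsimp only
    linarith
  set ψ : E → ℝ := fun x => ⨆ y : Y, (⟪x, (y : E)⟫ - l y) with hψ
  have hψge : ∀ x, ∀ y ∈ Y, ⟪x, y⟫ - l y ≤ ψ x := fun x y hy => le_ciSup (hbdd x) ⟨y, hy⟩
  refine ⟨ψ, fun x x' => ?_, fun i y hy y' hy' e => ?_⟩
  · rw [sub_le_iff_le_add]
    refine ciSup_le fun y => ?_
    have h1 := hψge x' y y.2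
    have h2 := hR (x - x') y y.2
    rw [inner_sub_left] at h2
    linarith
  · have h0 : ψ (p i) ≤ a i := ciSup_le fun y => hle i y y.2
    have h1 := hψge (p i + e) y (hCY i hy)
    have h2 := hψge (p i - e) y' (hCY i hy')
    have h3 := heq i y hy
    have h4 := heq i y' hy'
    rw [inner_add_left] at h1
    rw [inner_sub_left] at h2
    rw [inner_sub_right]
    linarith

theorem norm_le_sum_abs {n : ℕ} (z : EuclideanSpace ℝ (Fin n)) : ‖z‖ ≤ ∑ k, |z k| := by
  rw [EuclideanSpace.norm_eq]
  refine Real.sqrt_le_iff.2 ⟨Finset.sum_nonneg fun _ _ => abs_nonneg _, ?_⟩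
  simpa using Finset.sum_sq_le_sq_sum_of_nonneg (s := Finset.univ) (f := fun k => |z k|)
    fun _ _ => abs_nonneg _

/-- Cells of Laguerre type around `p i` have small diameter on average as soon as the empirical
measure of `p` is close to a measure which is stable under small translations. -/
theorem exists_cell_diameter_bound {n : ℕ} {X Y : Set (EuclideanSpace ℝ (Fin n))} {R : ℝ}
    (hX : ∀ x ∈ X, ‖x‖ ≤ R) (hYne : Y.Nonempty) (hY : ∀ y ∈ Y, ‖y‖ ≤ R)
    {μ : Measure (EuclideanSpace ℝ (Fin n))} [IsProbabilityMeasure μ] (hμX : μ Xᶜ = 0)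
    {t ε : ℝ} (ht : 0 < t)
    (htrans : ∀ (k : Fin n) (g : EuclideanSpace ℝ (Fin n) → ℝ) (C : ℝ), Measurable g →
      (∀ x, |g x| ≤ C) →
      |∫ x, g x ∂μ - ∫ x, g (x - t • EuclideanSpace.single k 1) ∂μ| ≤ C * ε)
    {N : ℕ} (hN : 1 ≤ N) {p : Fin N → EuclideanSpace ℝ (Fin n)} (hp : ∀ i, p i ∈ X) {δ : ℝ}
    {w : Fin N → EuclideanSpace ℝ (Fin n) → ℝ} (hw : IsTransportWeights μ p δ w)
    (l : EuclideanSpace ℝ (Fin n) → ℝ) (a : Fin N → ℝ)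
    (C : Fin N → Set (EuclideanSpace ℝ (Fin n))) (hCY : ∀ i, C i ⊆ Y)
    (hle : ∀ i, ∀ y ∈ Y, ⟪p i, y⟫ - l y ≤ a i) (heq : ∀ i, ∀ y ∈ C i, ⟪p i, y⟫ - l y = a i) :
    ∃ d : Fin N → ℝ, (∀ i, ∀ y ∈ C i, ∀ y' ∈ C i, ‖y - y'‖ ≤ d i) ∧
      (1 / (N : ℝ)) * ∑ i, d i ≤ n * (R * ε + 4 * R * δ / t) := by
  have : Nonempty (Fin N) := ⟨⟨0, hN⟩⟩
  have hR : 0 ≤ R := (norm_nonneg _).trans (hY _ hYne.some_mem)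
  obtain ⟨ψ, hψL, hψ⟩ := exists_lipschitz_potential hYne hY p l a C hCY hle heq
  have hψabs : ∀ x x', |ψ x - ψ x'| ≤ R * ‖x - x'‖ := fun x x' =>
    abs_le.2 ⟨by linarith [hψL x' x, norm_sub_rev x x' ▸ hψL x' x], hψL x x'⟩
  have hψm : Measurable ψ := by
    have : LipschitzWith ⟨R, hR⟩ ψ := LipschitzWith.of_dist_le_mul fun x x' => by
      rw [Real.dist_eq, dist_eq_norm]; exact hψabs x x'
    exact this.continuous.measurable
  let c : Fin n → EuclideanSpace ℝ (Fin n) := fun k => t • EuclideanSpace.single k 1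
  have hc : ∀ k, ‖c k‖ = t := fun k => by
    simp [c, norm_smul, abs_of_pos ht]
  let D : Fin n → EuclideanSpace ℝ (Fin n) → ℝ := fun k x =>
    ψ (x + c k) + ψ (x - c k) - 2 * ψ x
  have hDm : ∀ k, Measurable (D k) := fun k =>
    ((hψm.comp (measurable_id.add_const _)).add (hψm.comp (measurable_id.sub_const _))).sub
      (hψm.const_mul 2)
  have hGb : ∀ k x, |ψ (x + c k) - ψ x| ≤ R * t := fun k x => by
    have := hψabs (x + c k) x
    rwa [add_sub_cancel_left, hc] at this
  have hGm : ∀ k, Measurable fun x => ψ (x + c k) - ψ x := fun k =>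
    (hψm.comp (measurable_id.add_const _)).sub hψm
  have hDG : ∀ k x, D k x = (ψ (x + c k) - ψ x) - (ψ (x - c k + c k) - ψ (x - c k)) := fun k x => by
    simp only [D, sub_add_cancel]; ring
  have hDb : ∀ k x, |D k x| ≤ 2 * (R * t) := fun k x => by
    rw [hDG]
    refine (abs_sub _ _).trans ?_
    linarith [hGb k x, hGb k (x - c k)]
  have hDint : ∀ k, ∫ x, D k x ∂μ ≤ R * t * ε := fun k => by
    have h := htrans k _ _ (hGm k) (hGb k)
    rw [← integral_sub] at h
    · simp only [hDG]
      exact (le_abs_self _).trans h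
    · exact Integrable.of_bound (hGm k).aestronglyMeasurable (R * t) (.of_forall (hGb k))
    · exact Integrable.of_bound ((hGm k).comp (measurable_id.sub_const _)).aestronglyMeasurable
        (R * t) (.of_forall fun x => hGb k _)
  have hDL : ∀ k x y, D k y - D k x ≤ 4 * R * ‖x - y‖ := fun k x y => by
    have h1 := hψL (y + c k) (x + c k)
    have h2 := hψL (y - c k) (x - c k)
    have h3 := hψL x y
    rw [add_sub_add_right_eq_sub, norm_sub_rev] at h1
    rw [sub_sub_sub_cancel_right, norm_sub_rev] at h2
    simp only [D]
    linarith
  have havg : ∀ k, (1 / (N : ℝ)) * ∑ i, D k (p i) ≤ R * t * ε + 4 * R * δ := fun k =>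
    (hw.average_le hN hX hμX hp (hDm k) (hDb k) (by positivity) (hDL k)).trans
      (by linarith [hDint k])
  refine ⟨fun i => ∑ k, D k (p i) / t, fun i y hy y' hy' => ?_, ?_⟩
  · refine (norm_le_sum_abs _).trans (Finset.sum_le_sum fun k _ => ?_)
    rw [le_div_iff₀ ht]
    have h1 := hψ i y hy y' hy' (c k)
    have h2 := hψ i y' hy' y hy (c k)
    have e : ∀ z : EuclideanSpace ℝ (Fin n), ⟪c k, z⟫ = t * z k := fun z => by
      simp [c, inner_smul_left, EuclideanSpace.inner_single_left]
    rw [e] at h1 h2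
    have e2 : |(y - y') k| * t = |t * (y - y') k| := by rw [abs_mul, abs_of_pos ht, mul_comm]
    rw [e2]
    refine abs_le'.2 ⟨by linarith, ?_⟩
    have : (y' - y) k = -((y - y') k) := by simp
    rw [this] at h2
    linarith
  · rw [Finset.sum_comm, Finset.mul_sum]
    calc _ ≤ ∑ _k : Fin n, (R * ε + 4 * R * δ / t) := by
          refine Finset.sum_le_sum fun k _ => ?_
          rw [← Finset.sum_div, ← mul_div_assoc, div_le_iff₀ ht]
          refine (havg k).trans (le_of_eq ?_)
          field_simp
      _ = _ := by
          rw [Finset.sum_const, Finset.card_univ, Fintype.card_fin, nsmul_eq_mul]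

end CellDiameter

section LowerBound

theorem sq_norm_sub_sub_sq_norm_sub_le {E : Type*} [SeminormedAddCommGroup E] {R : ℝ} {a b z : E}
    (ha : ‖a‖ ≤ R) (hb : ‖b‖ ≤ R) (hz : ‖z‖ ≤ R) :
    ‖a - z‖ ^ 2 / 2 - ‖b - z‖ ^ 2 / 2 ≤ 2 * R * ‖a - b‖ := by
  have h1 : ‖a - z‖ - ‖b - z‖ ≤ ‖a - b‖ := by
    have := norm_sub_norm_le (a - z) (b - z); rwa [sub_sub_sub_cancel_right] at this
  have h2 : ‖a - z‖ ≤ 2 * R := (norm_sub_le _ _).trans (by linarith)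
  have h3 : ‖b - z‖ ≤ 2 * R := (norm_sub_le _ _).trans (by linarith)
  have h4 := mul_le_mul_of_nonneg_right h1 (add_nonneg (norm_nonneg (a - z)) (norm_nonneg (b - z)))
  have h5 := mul_le_mul_of_nonneg_left (add_le_add h2 h3) (norm_nonneg (a - b))
  nlinarith

/-- The Gibbs variational inequality for the relative entropy. -/
theorem integral_log_le_integral_log_rnDeriv_add {Y : Type*} [MeasurableSpace Y]
    {ν β : Measure Y} [IsProbabilityMeasure ν] [IsProbabilityMeasure β] (hβν : β ≪ ν)
    (hent : Integrable (fun y => Real.log ((β.rnDeriv ν y).toReal)) β)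
    {v : Y → ℝ} (hvm : Measurable v) (hv : ∀ y, 0 < v y) (hvν : Integrable v ν)
    (hvβ : Integrable (fun y => Real.log (v y)) β) :
    ∫ y, Real.log (v y) ∂β ≤
      ∫ y, Real.log ((β.rnDeriv ν y).toReal) ∂β + Real.log (∫ y, v y ∂ν) := by
  set ρ : Y → ℝ := fun y => (β.rnDeriv ν y).toReal with hρ
  have hρm : Measurable ρ := (Measure.measurable_rnDeriv β ν).ennreal_toReal
  have hI : 0 < ∫ y, v y ∂ν := by
    rw [integral_pos_iff_support_of_nonneg (fun y => (hv y).le) hvν]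
    have : Function.support v = Set.univ := by ext y; simp [(hv y).ne']
    rw [this]; simp
  set I := ∫ y, v y ∂ν with hIdef
  have hρpos : ∀ᵐ y ∂β, 0 < ρ y := by
    filter_upwards [Measure.rnDeriv_pos hβν, hβν.ae_le (Measure.rnDeriv_lt_top β ν)] with y h1 h2
    exact ENNReal.toReal_pos h1.ne' h2.ne
  have hle : ∀ y, ρ y • (v y / (I * ρ y)) ≤ v y / I := fun y => by
    rcases eq_or_lt_of_le (show 0 ≤ ρ y from ENNReal.toReal_nonneg) with h | h
    · rw [← h, zero_smul]; exact div_nonneg (hv y).le hI.le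
    · rw [smul_eq_mul]; apply le_of_eq; field_simp
  have hnn : ∀ y, 0 ≤ ρ y • (v y / (I * ρ y)) := fun y => by
    have : 0 ≤ ρ y := ENNReal.toReal_nonneg
    have := (hv y).le
    rw [smul_eq_mul]; positivity
  have hint' : Integrable (fun y => ρ y • (v y / (I * ρ y))) ν := by
    refine (hvν.div_const I).mono'
      (hρm.smul (hvm.div (hρm.const_mul I))).aestronglyMeasurable (.of_forall fun y => ?_)
    rw [Real.norm_of_nonneg (hnn y)]; exact hle y
  have hint : Integrable (fun y => v y / (I * ρ y)) β :=
    (integrable_rnDeriv_smul_iff hβν).1 hint'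
  have h1 : ∫ y, v y / (I * ρ y) ∂β ≤ 1 := by
    rw [← integral_rnDeriv_smul hβν]
    refine (integral_mono hint' (hvν.div_const I) hle).trans (le_of_eq ?_)
    rw [integral_div, div_self hI.ne']
  have hsub : Integrable (fun y => Real.log (v y) - Real.log (ρ y)) β := hvβ.sub hent
  have h3 : ∫ y, (Real.log (v y) - Real.log (ρ y) - Real.log I) ∂β ≤
      ∫ y, (v y / (I * ρ y) - 1) ∂β := by
    refine integral_mono_ae (hsub.sub (integrable_const _))
      (hint.sub (integrable_const _)) ?_
    filter_upwards [hρpos] with y hy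
    rw [sub_sub, ← Real.log_mul hy.ne' hI.ne', mul_comm (ρ y),
      ← Real.log_div (hv y).ne' (mul_pos hI hy).ne']
    exact Real.log_le_sub_one_of_pos (div_pos (hv y) (mul_pos hI hy))
  rw [integral_sub hsub (integrable_const _), integral_sub hvβ hent,
    integral_sub hint (integrable_const _)] at h3
  simp only [integral_const, probReal_univ, one_smul] at h3
  linarith

variable {n : ℕ}

theorem exists_coupling_lt (μ β : Measure (EuclideanSpace ℝ (Fin n))) [IsProbabilityMeasure μ]
    [IsProbabilityMeasure β] {ε : ℝ} (hε : 0 < ε) :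
    ∃ γ : Measure (EuclideanSpace ℝ (Fin n) × EuclideanSpace ℝ (Fin n)),
      IsProbabilityMeasure γ ∧ γ.map Prod.fst = μ ∧ γ.map Prod.snd = β ∧
      ∫ q, ‖q.1 - q.2‖ ^ 2 / 2 ∂γ < W2 μ β + ε := by
  obtain ⟨r, ⟨γ, h1, h2, h3, rfl⟩, hr⟩ := Real.lt_sInf_add_pos
    (s := {r : ℝ | ∃ γ : Measure (EuclideanSpace ℝ (Fin n) × EuclideanSpace ℝ (Fin n)),
      IsProbabilityMeasure γ ∧ γ.map Prod.fst = μ ∧ γ.map Prod.snd = β ∧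
      r = ∫ q, ‖q.1 - q.2‖ ^ 2 / 2 ∂γ})
    ⟨_, μ.prod β, inferInstance, by simp, by simp, rfl⟩ hε
  exact ⟨γ, h1, h2, h3, hr⟩

theorem W2_le_integral {μ β : Measure (EuclideanSpace ℝ (Fin n))}
    {γ : Measure (EuclideanSpace ℝ (Fin n) × EuclideanSpace ℝ (Fin n))}
    (h : IsProbabilityMeasure γ) (h1 : γ.map Prod.fst = μ) (h2 : γ.map Prod.snd = β) :
    W2 μ β ≤ ∫ q, ‖q.1 - q.2‖ ^ 2 / 2 ∂γ := by
  refine csInf_le ⟨0, ?_⟩ ⟨γ, h, h1, h2, rfl⟩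
  rintro _ ⟨γ', -, -, -, rfl⟩
  exact integral_nonneg fun q => by positivity

theorem integrable_cost {X Y : Set (EuclideanSpace ℝ (Fin n))} {R : ℝ}
    (hX : ∀ x ∈ X, ‖x‖ ≤ R) (hY : ∀ y ∈ Y, ‖y‖ ≤ R)
    {γ : Measure (EuclideanSpace ℝ (Fin n) × EuclideanSpace ℝ (Fin n))} [IsFiniteMeasure γ]
    (hγX : ∀ᵐ q ∂γ, q.1 ∈ X) (hγY : ∀ᵐ q ∂γ, q.2 ∈ Y) :
    Integrable (fun q => ‖q.1 - q.2‖ ^ 2 / 2) γ := by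
  refine Integrable.of_bound (C := (2 * R) ^ 2 / 2) (by fun_prop) ?_
  filter_upwards [hγX, hγY] with q h1 h2
  rw [Real.norm_of_nonneg (by positivity)]
  have : ‖q.1 - q.2‖ ≤ 2 * R := (norm_sub_le _ _).trans (by linarith [hX _ h1, hY _ h2])
  gcongr

theorem le_nash_value {X Y : Set (EuclideanSpace ℝ (Fin n))} {R : ℝ} (hR : 0 ≤ R)
    (hX : ∀ x ∈ X, ‖x‖ ≤ R) (hY : ∀ y ∈ Y, ‖y‖ ≤ R)
    {μ ν β : Measure (EuclideanSpace ℝ (Fin n))} [IsProbabilityMeasure μ]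
    [IsProbabilityMeasure ν] [IsProbabilityMeasure β] (hμX : μ Xᶜ = 0) (hβY : β Yᶜ = 0)
    (hβν : β ≪ ν) (hent : Integrable (fun y => Real.log ((β.rnDeriv ν y).toReal)) β)
    {N : ℕ} (hN : 1 ≤ N) {p : Fin N → EuclideanSpace ℝ (Fin n)} (hp : ∀ i, p i ∈ X) {δ : ℝ}
    {w : Fin N → EuclideanSpace ℝ (Fin n) → ℝ} (hw : IsTransportWeights μ p δ w)
    {u : Fin N → ℝ} (hu : ∀ i, 0 < u i) {v : EuclideanSpace ℝ (Fin n) → ℝ} (hvm : Measurable v)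
    (hle : ∀ i y, Real.exp (-‖p i - y‖ ^ 2 / 2) ≤ u i * v y)
    (heq : ∀ y, ∃ i, Real.exp (-‖p i - y‖ ^ 2 / 2) = u i * v y) (hvN : ∫ y, v y ∂ν = N) :
    -(∫ y, Real.log ((β.rnDeriv ν y).toReal) ∂β) - W2 μ β ≤
      Real.log N + (1 / (N : ℝ)) * ∑ i, Real.log (u i) + 2 * R * δ := by
  have hNpos : (0 : ℝ) < N := by exact_mod_cast hN
  have hμX' : ∀ᵐ x ∂μ, x ∈ X := by rw [ae_iff]; exact hμX
  have hβY' : ∀ᵐ y ∂β, y ∈ Y := by rw [ae_iff]; exact hβY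
  have hv : ∀ y, 0 < v y := fun y =>
    pos_of_mul_pos_right ((Real.exp_pos _).trans_le (hle ⟨0, hN⟩ y)) (hu _).le
  have hvle : ∀ y, v y ≤ ∑ i, 1 / u i := fun y => by
    obtain ⟨i, hi⟩ := heq y
    have h1 : v y ≤ 1 / u i := by
      rw [le_div_iff₀ (hu i), mul_comm, ← hi, Real.exp_le_one_iff]
      have := sq_nonneg ‖p i - y‖
      linarith
    exact h1.trans (Finset.single_le_sum (f := fun i => 1 / u i)
      (fun i _ => (one_div_pos.2 (hu i)).le) (Finset.mem_univ i))
  have hlog : ∀ i y, -(‖p i - y‖ ^ 2 / 2) ≤ Real.log (u i) + Real.log (v y) := fun i y => by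
    rw [← Real.log_mul (hu i).ne' (hv y).ne', Real.le_log_iff_exp_le (mul_pos (hu i) (hv y)),
      ← neg_div]
    exact hle i y
  have hvν : Integrable v ν := Integrable.of_bound hvm.aestronglyMeasurable (∑ i, 1 / u i)
    (.of_forall fun y => by rw [Real.norm_of_nonneg (hv y).le]; exact hvle y)
  have hlogv : Integrable (fun y => Real.log (v y)) β := by
    set i₀ : Fin N := ⟨0, hN⟩
    refine Integrable.of_bound (Real.measurable_log.comp hvm).aestronglyMeasurable
      (max (Real.log (∑ i, 1 / u i)) ((2 * R) ^ 2 / 2 + Real.log (u i₀))) ?_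
    filter_upwards [hβY'] with y hy
    rw [Real.norm_eq_abs]
    refine abs_le'.2 ⟨(Real.log_le_log (hv y) (hvle y)).trans (le_max_left _ _), ?_⟩
    refine le_trans ?_ (le_max_right _ _)
    have h1 := hlog i₀ y
    have h2 : ‖p i₀ - y‖ ≤ 2 * R := (norm_sub_le _ _).trans (by linarith [hX _ (hp i₀), hY _ hy])
    have h3 : ‖p i₀ - y‖ ^ 2 ≤ (2 * R) ^ 2 := by gcongr
    linarith
  have hgibbs := integral_log_le_integral_log_rnDeriv_add hβν hent hvm hv hvν hlogv
  rw [hvN] at hgibbs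
  refine le_of_forall_pos_le_add fun ε hε => ?_
  obtain ⟨γ, hγ, hγ1, hγ2, hγε⟩ := exists_coupling_lt μ β hε
  have hγX : ∀ᵐ q ∂γ, q.1 ∈ X := ae_of_ae_map measurable_fst.aemeasurable (by rwa [hγ1])
  have hγY : ∀ᵐ q ∂γ, q.2 ∈ Y := ae_of_ae_map measurable_snd.aemeasurable (by rwa [hγ2])
  have hcost := integrable_cost hX hY hγX hγY
  have hfst : ∀ f : EuclideanSpace ℝ (Fin n) → ℝ, Integrable f μ →
      Integrable (fun q => f q.1) γ ∧ ∫ q, f q.1 ∂γ = ∫ x, f x ∂μ := fun f hf => by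
    rw [← hγ1] at hf
    exact ⟨hf.comp_measurable measurable_fst, by
      rw [← hγ1, integral_map measurable_fst.aemeasurable hf.aestronglyMeasurable]⟩
  have hsnd : ∀ f : EuclideanSpace ℝ (Fin n) → ℝ, Integrable f β →
      Integrable (fun q => f q.2) γ ∧ ∫ q, f q.2 ∂γ = ∫ x, f x ∂β := fun f hf => by
    rw [← hγ2] at hf
    exact ⟨hf.comp_measurable measurable_snd, by
      rw [← hγ2, integral_map measurable_snd.aemeasurable hf.aestronglyMeasurable]⟩
  have hwi := fun i => hfst _ (hw.integrable i)
  have hdi := fun i => hfst _ (hw.integrable_norm_sub_mul hX hμX hp i)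
  have hlv := hsnd _ hlogv
  have hI1 : Integrable (fun q : EuclideanSpace ℝ (Fin n) × EuclideanSpace ℝ (Fin n) =>
      ∑ i, w i q.1 * Real.log (u i)) γ :=
    integrable_finsetSum _ fun i _ => (hwi i).1.mul_const _
  have hI2 : Integrable (fun q : EuclideanSpace ℝ (Fin n) × EuclideanSpace ℝ (Fin n) =>
      N * (Real.log (v q.2) + ‖q.1 - q.2‖ ^ 2 / 2)) γ := (hlv.1.add hcost).const_mul _
  have hI3 : Integrable (fun q : EuclideanSpace ℝ (Fin n) × EuclideanSpace ℝ (Fin n) =>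
      ∑ i, 2 * R * (‖q.1 - p i‖ * w i q.1)) γ :=
    integrable_finsetSum _ fun i _ => (hdi i).1.const_mul _
  have hI12 : Integrable (fun q : EuclideanSpace ℝ (Fin n) × EuclideanSpace ℝ (Fin n) =>
      ∑ i, w i q.1 * Real.log (u i) + N * (Real.log (v q.2) + ‖q.1 - q.2‖ ^ 2 / 2)) γ :=
    hI1.add hI2
  have hkey : 0 ≤ ∫ q, (∑ i, w i q.1 * Real.log (u i) +
      N * (Real.log (v q.2) + ‖q.1 - q.2‖ ^ 2 / 2) + ∑ i, 2 * R * (‖q.1 - p i‖ * w i q.1)) ∂γ := by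
    refine integral_nonneg_of_ae ?_
    have hsum : ∀ᵐ q ∂γ, ∑ i, w i q.1 = N :=
      ae_of_ae_map measurable_fst.aemeasurable (by rw [hγ1]; exact hw.sum_eq)
    filter_upwards [hsum, hγX, hγY] with q h1 h2 h3
    rw [← h1, Finset.sum_mul, ← Finset.sum_add_distrib, ← Finset.sum_add_distrib]
    refine Finset.sum_nonneg fun i _ => ?_
    have h4 := sq_norm_sub_sub_sq_norm_sub_le (hX _ (hp i)) (hX _ h2) (hY _ h3)
    rw [norm_sub_rev (p i) q.1] at h4
    have h5 := mul_nonneg (hw.nonneg i q.1)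
      (show 0 ≤ Real.log (u i) + (Real.log (v q.2) + ‖q.1 - q.2‖ ^ 2 / 2) +
        2 * R * ‖q.1 - p i‖ by linarith [hlog i q.2])
    linarith
  rw [integral_add hI12 hI3, integral_add hI1 hI2, integral_const_mul,
    integral_add hlv.1 hcost, hlv.2, integral_finsetSum _ fun i _ => (hwi i).1.mul_const _,
    integral_finsetSum _ fun i _ => (hdi i).1.const_mul _] at hkey
  simp only [integral_const_mul, integral_mul_const, (hwi _).2, (hdi _).2, hw.integral_eq_one,
    one_mul] at hkey
  rw [← Finset.mul_sum] at hkey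
  have h6 := mul_nonneg (one_div_pos.2 hNpos).le hkey
  rw [mul_add, mul_add, ← mul_assoc _ (N : ℝ), one_div_mul_cancel hNpos.ne', one_mul,
    mul_left_comm] at h6
  have h7 := mul_le_mul_of_nonneg_left hw.cost_le (show 0 ≤ 2 * R by positivity)
  linarith

end LowerBound

section AveragedMarginal

variable {Y : Type*} [MeasurableSpace Y]

/-- The average of the normalizations of the measures `m i`. -/
noncomputable def averagedMarginal {N : ℕ} (m : Fin N → Measure Y) : Measure Y :=
  (N : ENNReal)⁻¹ • ∑ i, (m i Set.univ)⁻¹ • m i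

theorem isProbabilityMeasure_normalize {m : Measure Y} [IsFiniteMeasure m]
    (hm : m Set.univ ≠ 0) : IsProbabilityMeasure ((m Set.univ)⁻¹ • m) :=
  ⟨by rw [Measure.smul_apply, smul_eq_mul, ENNReal.inv_mul_cancel hm (measure_ne_top _ _)]⟩

theorem isProbabilityMeasure_averagedMarginal {N : ℕ} (hN : 1 ≤ N) {m : Fin N → Measure Y}
    [∀ i, IsFiniteMeasure (m i)] (hm : ∀ i, m i Set.univ ≠ 0) :
    IsProbabilityMeasure (averagedMarginal m) := by
  have hN0 : (N : ENNReal) ≠ 0 := by simp; omega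
  refine ⟨?_⟩
  have h : ∀ i, ((m i Set.univ)⁻¹ • m i) Set.univ = 1 := fun i => by
    have := isProbabilityMeasure_normalize (hm i)
    exact measure_univ
  rw [averagedMarginal, Measure.smul_apply, Measure.finsetSum_apply]
  simp only [h, Finset.sum_const, Finset.card_univ, Fintype.card_fin, nsmul_eq_mul, mul_one,
    smul_eq_mul]
  exact ENNReal.inv_mul_cancel hN0 (ENNReal.natCast_ne_top N)

theorem averagedMarginal_absolutelyContinuous {N : ℕ} {m : Fin N → Measure Y} {ν : Measure Y}
    (hm : ∑ i, m i = ν) : averagedMarginal m ≪ ν := by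
  have hac : ∀ i, m i ≪ ν := fun i => by
    rw [← hm]
    exact Measure.absolutelyContinuous_of_le (Finset.single_le_sum (f := m)
      (fun _ _ => Measure.zero_le _) (Finset.mem_univ i))
  refine Measure.AbsolutelyContinuous.mk fun s _ h => ?_
  rw [averagedMarginal, Measure.smul_apply, Measure.finsetSum_apply]
  simp [fun i => hac i h]

theorem averagedMarginal_entropy_le {ν : Measure Y} [IsProbabilityMeasure ν] {N : ℕ} (hN : 1 ≤ N)
    {m : Fin N → Measure Y} (hm : ∑ i, m i = ν) (hpos : ∀ i, m i Set.univ ≠ 0) :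
    Integrable (fun y => Real.log (((averagedMarginal m).rnDeriv ν y).toReal))
      (averagedMarginal m) ∧
    ∫ y, Real.log (((averagedMarginal m).rnDeriv ν y).toReal) ∂(averagedMarginal m) ≤
      -Real.log N - (1 / (N : ℝ)) * ∑ i, Real.log ((m i Set.univ).toReal) := by
  have hNpos : (0 : ℝ) < N := by exact_mod_cast hN
  have hle : ∀ i, m i ≤ ν := fun i => by
    rw [← hm]
    exact Finset.single_le_sum (f := m) (fun _ _ => Measure.zero_le _) (Finset.mem_univ i)
  have hfin : ∀ i, IsFiniteMeasure (m i) := fun i =>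
    ⟨((hle i) Set.univ).trans_lt (measure_lt_top ν _)⟩
  have hac : ∀ i, m i ≪ ν := fun i => Measure.absolutelyContinuous_of_le (hle i)
  have hprob := isProbabilityMeasure_averagedMarginal hN hpos
  have hβν := averagedMarginal_absolutelyContinuous hm
  set β := averagedMarginal m with hβ
  set f : Fin N → Y → ℝ := fun i y => ((m i).rnDeriv ν y).toReal with hf
  have hfm : ∀ i, Measurable (f i) := fun i => (Measure.measurable_rnDeriv _ _).ennreal_toReal
  have hf0 : ∀ i y, 0 ≤ f i y := fun i y => ENNReal.toReal_nonneg
  have hfint : ∀ i, Integrable (f i) ν := fun i => Measure.integrable_toReal_rnDeriv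
  have hfI : ∀ i, ∫ y, f i y ∂ν = (m i Set.univ).toReal := fun i =>
    Measure.integral_toReal_rnDeriv (hac i)
  set M : Fin N → ℝ := fun i => (m i Set.univ).toReal with hM
  have hMpos : ∀ i, 0 < M i := fun i => ENNReal.toReal_pos (hpos i) (measure_ne_top _ _)
  set a : Fin N → ℝ := fun i => (N : ℝ)⁻¹ * (M i)⁻¹ with ha
  have hapos : ∀ i, 0 < a i := fun i => by have := hMpos i; positivity
  have hrn : ∀ i, ∀ᵐ y ∂ν, (m i).rnDeriv ν y < ⊤ := fun i => Measure.rnDeriv_lt_top _ _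
  have hsum : ∀ᵐ y ∂ν, ∑ i, f i y = 1 := by
    have h1 : ν = ν.withDensity (fun y => ∑ i, (m i).rnDeriv ν y) := by
      ext B hB
      rw [withDensity_apply _ hB, lintegral_finsetSum _ fun i _ => Measure.measurable_rnDeriv _ _]
      simp_rw [Measure.setLIntegral_rnDeriv (hac _)]
      rw [← Measure.finsetSum_apply, hm]
    have h2 : (fun y => ∑ i, (m i).rnDeriv ν y) =ᵐ[ν] ν.rnDeriv ν := by
      have := Measure.rnDeriv_withDensity ν (f := fun y => ∑ i, (m i).rnDeriv ν y)
        (Finset.measurable_fun_sum _ fun i _ => Measure.measurable_rnDeriv _ _)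
      rw [← h1] at this
      exact this.symm
    filter_upwards [h2, Measure.rnDeriv_self ν, ae_all_iff.2 hrn] with y h3 h4 h5
    rw [h4] at h3
    rw [← ENNReal.toReal_sum fun i _ => (h5 i).ne, h3, ENNReal.toReal_one]
  have hρ : ∀ᵐ y ∂ν, (β.rnDeriv ν y).toReal = ∑ i, a i * f i y := by
    have h1 : β = ν.withDensity
        (fun y => ∑ i, (N : ENNReal)⁻¹ * (m i Set.univ)⁻¹ * (m i).rnDeriv ν y) := by
      ext B hB
      rw [withDensity_apply _ hB, lintegral_finsetSum _ fun i _ =>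
        (Measure.measurable_rnDeriv _ _).const_mul _]
      simp_rw [lintegral_const_mul _ (Measure.measurable_rnDeriv _ _),
        Measure.setLIntegral_rnDeriv (hac _)]
      rw [hβ, averagedMarginal, Measure.smul_apply, Measure.finsetSum_apply, smul_eq_mul,
        Finset.mul_sum]
      simp [mul_assoc]
    have h2 := Measure.rnDeriv_withDensity ν
      (f := fun y => ∑ i, (N : ENNReal)⁻¹ * (m i Set.univ)⁻¹ * (m i).rnDeriv ν y)
      (Finset.measurable_fun_sum _ fun i _ => (Measure.measurable_rnDeriv _ _).const_mul _)
    rw [← h1] at h2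
    have h0 : ∀ i, (N : ENNReal)⁻¹ * (m i Set.univ)⁻¹ ≠ ⊤ := fun i =>
      ENNReal.mul_ne_top (ENNReal.inv_ne_top.2 (by simp; omega)) (ENNReal.inv_ne_top.2 (hpos i))
    filter_upwards [h2, ae_all_iff.2 hrn] with y h3 h4
    rw [h3, ENNReal.toReal_sum fun i _ => ENNReal.mul_ne_top (h0 i) (h4 i).ne]
    simp [a, M, f]
  have hconv : ∀ᵐ y ∂ν, (∑ i, a i * f i y) * Real.log (∑ i, a i * f i y) ≤
      ∑ i, a i * Real.log (a i) * f i y := by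
    filter_upwards [hsum] with y hy
    have := Real.convexOn_mul_log.map_sum_le (t := Finset.univ) (w := fun i => f i y) (p := a)
      (fun i _ => hf0 i y) hy (fun i _ => (hapos i).le)
    simp only [smul_eq_mul] at this
    simpa only [mul_comm (f _ y)] using this
  obtain ⟨K, hK⟩ : ∃ K, ∀ i, |Real.log (a i)| ≤ K :=
    ⟨∑ i, |Real.log (a i)|, fun i => Finset.single_le_sum (f := fun i => |Real.log (a i)|)
      (fun _ _ => abs_nonneg _) (Finset.mem_univ i)⟩
  have hbd : ∀ᵐ y ∂ν, |Real.log (∑ i, a i * f i y)| ≤ K := by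
    filter_upwards [hsum] with y hy
    have hexp : ∀ i, Real.exp (-K) ≤ a i ∧ a i ≤ Real.exp K := fun i =>
      ⟨(Real.le_log_iff_exp_le (hapos i)).1 (abs_le.1 (hK i)).1,
        (Real.log_le_iff_le_exp (hapos i)).1 (abs_le.1 (hK i)).2⟩
    have h1 : Real.exp (-K) ≤ ∑ i, a i * f i y := by
      rw [← mul_one (Real.exp (-K)), ← hy, Finset.mul_sum]
      exact Finset.sum_le_sum fun i _ => mul_le_mul_of_nonneg_right (hexp i).1 (hf0 i y)
    have h2 : ∑ i, a i * f i y ≤ Real.exp K := by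
      rw [← mul_one (Real.exp K), ← hy, Finset.mul_sum]
      exact Finset.sum_le_sum fun i _ => mul_le_mul_of_nonneg_right (hexp i).2 (hf0 i y)
    have h3 := (Real.exp_pos (-K)).trans_le h1
    exact abs_le.2 ⟨(Real.le_log_iff_exp_le h3).2 h1, (Real.log_le_iff_le_exp h3).2 h2⟩
  have hentν : ∀ᵐ y ∂ν, |Real.log ((β.rnDeriv ν y).toReal)| ≤ K := by
    filter_upwards [hρ, hbd] with y h1 h2
    rwa [h1]
  have hint : Integrable (fun y => Real.log ((β.rnDeriv ν y).toReal)) β :=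
    Integrable.of_bound
      (Real.measurable_log.comp (Measure.measurable_rnDeriv _ _).ennreal_toReal).aestronglyMeasurable
      K (hβν.ae_le hentν)
  refine ⟨hint, ?_⟩
  have hint' := (integrable_rnDeriv_smul_iff hβν).2 hint
  rw [← integral_rnDeriv_smul hβν]
  calc _ ≤ ∫ y, ∑ i, a i * Real.log (a i) * f i y ∂ν := by
        refine integral_mono_ae hint'
          (integrable_finsetSum _ fun i _ => (hfint i).const_mul _) ?_
        filter_upwards [hρ, hconv] with y h1 h2
        rwa [smul_eq_mul, h1]
    _ = ∑ i, a i * Real.log (a i) * M i := by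
        rw [integral_finsetSum _ fun i _ => (hfint i).const_mul _]
        simp_rw [integral_const_mul, hfI]
        rfl
    _ = ∑ i, (1 / (N : ℝ)) * (-Real.log N - Real.log (M i)) := by
        refine Finset.sum_congr rfl fun i _ => ?_
        have h := (hMpos i).ne'
        rw [show Real.log (a i) = -Real.log N - Real.log (M i) by
          rw [ha, Real.log_mul (inv_ne_zero hNpos.ne') (inv_ne_zero h), Real.log_inv, Real.log_inv]
          ring]
        simp only [ha]
        field_simp
    _ = _ := by
        rw [← Finset.mul_sum, Finset.sum_sub_distrib, Finset.sum_const, Finset.card_univ,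
          Fintype.card_fin, nsmul_eq_mul, mul_sub, ← mul_assoc, one_div_mul_cancel hNpos.ne',
          one_mul]

end AveragedMarginal

section TransportUpperBound

variable {n : ℕ}

theorem W2_average_le {X Y : Set (EuclideanSpace ℝ (Fin n))} {R : ℝ} (hR : 0 ≤ R)
    (hX : ∀ x ∈ X, ‖x‖ ≤ R) (hY : ∀ y ∈ Y, ‖y‖ ≤ R)
    {μ : Measure (EuclideanSpace ℝ (Fin n))} [IsProbabilityMeasure μ] (hμX : μ Xᶜ = 0)
    {N : ℕ} (hN : 1 ≤ N) {p : Fin N → EuclideanSpace ℝ (Fin n)} (hp : ∀ i, p i ∈ X) {δ : ℝ}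
    {w : Fin N → EuclideanSpace ℝ (Fin n) → ℝ} (hw : IsTransportWeights μ p δ w)
    {b : Fin N → Measure (EuclideanSpace ℝ (Fin n))} (hb : ∀ i, IsProbabilityMeasure (b i))
    (hbY : ∀ i, b i Yᶜ = 0) :
    W2 μ ((N : ENNReal)⁻¹ • ∑ i, b i) ≤
      (1 / (N : ℝ)) * ∑ i, ∫ y, ‖p i - y‖ ^ 2 / 2 ∂(b i) + 2 * R * δ := by
  have hNpos : (0 : ℝ) < N := by exact_mod_cast hN
  have hN0 : (N : ENNReal) ≠ 0 := by simp; omega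
  have hNinv : (N : ENNReal)⁻¹ * N = 1 := ENNReal.inv_mul_cancel hN0 (ENNReal.natCast_ne_top N)
  have hμX' : ∀ᵐ x ∂μ, x ∈ X := by rw [ae_iff]; exact hμX
  have hbY' : ∀ i, ∀ᵐ y ∂(b i), y ∈ Y := fun i => by rw [ae_iff]; exact hbY i
  have hwm : ∀ i, Measurable fun x => ENNReal.ofReal (w i x) := fun i =>
    (hw.measurable i).ennreal_ofReal
  set μi : Fin N → Measure (EuclideanSpace ℝ (Fin n)) := fun i =>
    μ.withDensity fun x => ENNReal.ofReal (w i x) with hμi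
  have hμiprob : ∀ i, IsProbabilityMeasure (μi i) := fun i => ⟨by
    rw [hμi, withDensity_apply _ .univ, Measure.restrict_univ,
      ← ofReal_integral_eq_lintegral_ofReal (hw.integrable i) (.of_forall (hw.nonneg i)),
      hw.integral_eq_one, ENNReal.ofReal_one]⟩
  have hμisum : ∑ i, μi i = (N : ENNReal) • μ := by
    ext B hB
    rw [Measure.finsetSum_apply, Measure.smul_apply, smul_eq_mul]
    simp only [hμi, withDensity_apply _ hB]
    rw [← lintegral_finsetSum _ fun i _ => hwm i, ← setLIntegral_const]
    refine lintegral_congr_ae (ae_restrict_of_ae ?_)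
    filter_upwards [hw.sum_eq] with x hx
    rw [← ENNReal.ofReal_sum_of_nonneg fun i _ => hw.nonneg i x, hx, ENNReal.ofReal_natCast]
  set γi := fun i => (μi i).prod (b i) with hγi
  set γ := (N : ENNReal)⁻¹ • ∑ i, γi i with hγ
  have hγ1 : γ.map Prod.fst = μ := by
    rw [hγ, Measure.map_smul, Measure.map_finset_sum measurable_fst.aemeasurable]
    simp only [hγi, Measure.map_fst_prod, measure_univ, one_smul]
    rw [hμisum, smul_smul, hNinv, one_smul]
  have hγ2 : γ.map Prod.snd = (N : ENNReal)⁻¹ • ∑ i, b i := by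
    rw [hγ, Measure.map_smul, Measure.map_finset_sum measurable_snd.aemeasurable]
    simp only [hγi, Measure.map_snd_prod, measure_univ, one_smul]
  have hγprob : IsProbabilityMeasure γ := by
    rw [← Measure.isProbabilityMeasure_map_iff measurable_fst.aemeasurable, hγ1]
    infer_instance
  refine (W2_le_integral hγprob hγ1 hγ2).trans ?_
  have hX1 : ∀ i, ∀ᵐ q ∂(γi i), q.1 ∈ X := fun i => by
    refine ae_of_ae_map measurable_fst.aemeasurable (p := fun x => x ∈ X) ?_
    simp only [hγi, Measure.map_fst_prod, measure_univ, one_smul]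
    exact (withDensity_absolutelyContinuous _ _).ae_le hμX'
  have hY1 : ∀ i, ∀ᵐ q ∂(γi i), q.2 ∈ Y := fun i => by
    refine ae_of_ae_map measurable_snd.aemeasurable (p := fun x => x ∈ Y) ?_
    simp only [hγi, Measure.map_snd_prod, measure_univ, one_smul]
    exact hbY' i
  have hcost : ∀ i, Integrable (fun q => ‖q.1 - q.2‖ ^ 2 / 2) (γi i) := fun i =>
    integrable_cost hX hY (hX1 i) (hY1 i)
  have hb1 : ∀ i, Integrable (fun y => ‖p i - y‖ ^ 2 / 2) (b i) := fun i => by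
    refine Integrable.of_bound (C := (2 * R) ^ 2 / 2) (by fun_prop) ?_
    filter_upwards [hbY' i] with y h
    rw [Real.norm_of_nonneg (by positivity)]
    have : ‖p i - y‖ ≤ 2 * R := (norm_sub_le _ _).trans (by linarith [hX _ (hp i), hY _ h])
    gcongr
  have hd1 : ∀ i, Integrable (fun x => ‖x - p i‖) (μi i) := fun i => by
    refine Integrable.of_bound (C := 2 * R) (by fun_prop) ?_
    filter_upwards [(withDensity_absolutelyContinuous _ _).ae_le hμX'] with x h
    rw [norm_norm]
    exact (norm_sub_le _ _).trans (by linarith [hX _ (hp i), hX _ h])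
  have hdI : ∀ i, ∫ x, ‖x - p i‖ ∂(μi i) = ∫ x, ‖x - p i‖ * w i x ∂μ := fun i => by
    rw [hμi, integral_withDensity_eq_integral_toReal_smul (hwm i)
      (.of_forall fun x => ENNReal.ofReal_lt_top)]
    refine integral_congr_ae (.of_forall fun x => ?_)
    dsimp only
    rw [ENNReal.toReal_ofReal (hw.nonneg i x), smul_eq_mul, mul_comm]
  have hle : ∀ i, ∫ q, ‖q.1 - q.2‖ ^ 2 / 2 ∂(γi i) ≤
      ∫ y, ‖p i - y‖ ^ 2 / 2 ∂(b i) + 2 * R * ∫ x, ‖x - p i‖ * w i x ∂μ := fun i => by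
    have h1 : Integrable (fun q : EuclideanSpace ℝ (Fin n) × EuclideanSpace ℝ (Fin n) =>
        ‖p i - q.2‖ ^ 2 / 2) (γi i) := (hb1 i).comp_snd (μi i)
    have h2 : Integrable (fun q : EuclideanSpace ℝ (Fin n) × EuclideanSpace ℝ (Fin n) =>
        ‖q.1 - p i‖) (γi i) := (hd1 i).comp_fst (b i)
    calc _ ≤ ∫ q, (‖p i - q.2‖ ^ 2 / 2 + 2 * R * ‖q.1 - p i‖) ∂(γi i) := by
          refine integral_mono_ae (hcost i) (h1.add (h2.const_mul (2 * R))) ?_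
          filter_upwards [hX1 i, hY1 i] with q h3 h4
          have := sq_norm_sub_sub_sq_norm_sub_le (hX _ h3) (hX _ (hp i)) (hY _ h4)
          linarith
      _ = _ := by
          have h3 := integral_fun_snd (μ := μi i) (ν := b i) (fun y => ‖p i - y‖ ^ 2 / 2)
          have h4 := integral_fun_fst (μ := μi i) (ν := b i) (fun x => ‖x - p i‖)
          rw [probReal_univ, one_smul] at h3 h4
          rw [integral_add h1 (h2.const_mul (2 * R)), integral_const_mul, ← hdI, ← h3, ← h4]
  rw [hγ, integral_smul_measure, integral_finsetSum_measure fun i _ => hcost i]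
  have h3 := mul_le_mul_of_nonneg_left hw.cost_le (show 0 ≤ 2 * R by positivity)
  have h4 := mul_le_mul_of_nonneg_left (Finset.sum_le_sum fun i (_ : i ∈ Finset.univ) => hle i)
    (one_div_pos.2 hNpos).le
  rw [Finset.sum_add_distrib, ← Finset.mul_sum, mul_add, mul_left_comm] at h4
  rw [ENNReal.toReal_inv, ENNReal.toReal_natCast, smul_eq_mul, ← one_div]
  linarith

end TransportUpperBound

section UpperBound

variable {n : ℕ}

theorem log_integral_exp_neg_le {Y : Type*} [MeasurableSpace Y] {b : Measure Y}
    [IsProbabilityMeasure b] {c : Y → ℝ} (hc : Integrable c b) {C : Set Y} (hC : ∀ᵐ y ∂b, y ∈ C)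
    {D : ℝ} (hcC : ∀ y ∈ C, ∀ y' ∈ C, c y - c y' ≤ D) (hpos : 0 < ∫ y, Real.exp (-c y) ∂b) :
    Real.log (∫ y, Real.exp (-c y) ∂b) ≤ -∫ y, c y ∂b + D := by
  rw [Real.log_le_iff_le_exp hpos]
  have h : ∀ y ∈ C, ∫ y, c y ∂b - D ≤ c y := fun y hy => by
    have h1 : ∫ z, c z ∂b ≤ ∫ _, (c y + D) ∂b := by
      refine integral_mono_ae hc (integrable_const _) ?_
      filter_upwards [hC] with z hz
      linarith [hcC z hz y hy]
    rw [integral_const, probReal_univ, one_smul] at h1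
    linarith
  have h2 : ∫ y, Real.exp (-c y) ∂b ≤ ∫ _, Real.exp (-∫ y, c y ∂b + D) ∂b := by
    refine integral_mono_of_nonneg (.of_forall fun y => (Real.exp_pos _).le)
      (integrable_const _) ?_
    filter_upwards [hC] with y hy
    exact Real.exp_le_exp.2 (by linarith [h y hy])
  rwa [integral_const, probReal_univ, one_smul] at h2

theorem nash_value_le {X Y : Set (EuclideanSpace ℝ (Fin n))} {R : ℝ} (hR : 0 ≤ R)
    (hX : ∀ x ∈ X, ‖x‖ ≤ R) (hY : ∀ y ∈ Y, ‖y‖ ≤ R)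
    {μ ν : Measure (EuclideanSpace ℝ (Fin n))} [IsProbabilityMeasure μ]
    [IsProbabilityMeasure ν] (hμX : μ Xᶜ = 0) (hνY : ν Yᶜ = 0)
    {N : ℕ} (hN : 1 ≤ N) {p : Fin N → EuclideanSpace ℝ (Fin n)} (hp : ∀ i, p i ∈ X) {δ : ℝ}
    {w : Fin N → EuclideanSpace ℝ (Fin n) → ℝ} (hw : IsTransportWeights μ p δ w)
    {m : Fin N → Measure (EuclideanSpace ℝ (Fin n))} (hm : ∑ i, m i = ν)
    {u : Fin N → ℝ} (hum : ∀ i, u i = ∫ y, Real.exp (-‖p i - y‖ ^ 2 / 2) ∂(m i))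
    (hu : ∀ i, 0 < u i) {C : Fin N → Set (EuclideanSpace ℝ (Fin n))}
    (hCY : ∀ i, C i ⊆ Y) (hC : ∀ i, ∀ᵐ y ∂(m i), y ∈ C i) {d : Fin N → ℝ}
    (hd : ∀ i, ∀ y ∈ C i, ∀ y' ∈ C i, ‖y - y'‖ ≤ d i) :
    Real.log N + (1 / (N : ℝ)) * ∑ i, Real.log (u i) ≤
      -(∫ y, Real.log (((averagedMarginal m).rnDeriv ν y).toReal) ∂(averagedMarginal m)) -
        W2 μ (averagedMarginal m) + (2 * R * δ + 2 * R * ((1 / (N : ℝ)) * ∑ i, d i)) := by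
  have hNpos : (0 : ℝ) < N := by exact_mod_cast hN
  have hle : ∀ i, m i ≤ ν := fun i => by
    rw [← hm]
    exact Finset.single_le_sum (f := m) (fun _ _ => Measure.zero_le _) (Finset.mem_univ i)
  have hfin : ∀ i, IsFiniteMeasure (m i) := fun i =>
    ⟨((hle i) Set.univ).trans_lt (measure_lt_top ν _)⟩
  have hpos : ∀ i, m i Set.univ ≠ 0 := fun i h => by
    have h1 := hu i
    rw [hum, Measure.measure_univ_eq_zero.1 h, integral_zero_measure] at h1
    exact h1.false
  set b : Fin N → Measure (EuclideanSpace ℝ (Fin n)) := fun i => (m i Set.univ)⁻¹ • m i with hb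
  have hbprob : ∀ i, IsProbabilityMeasure (b i) := fun i =>
    isProbabilityMeasure_normalize (hpos i)
  have hbm : ∀ i, b i ≪ m i := fun i => Measure.smul_absolutelyContinuous
  have hbC : ∀ i, ∀ᵐ y ∂(b i), y ∈ C i := fun i => (hbm i).ae_le (hC i)
  have hbY : ∀ i, b i Yᶜ = 0 := fun i =>
    hbm i (nonpos_iff_eq_zero.1 ((hle i Yᶜ).trans hνY.le))
  have hc : ∀ i, Integrable (fun y => ‖p i - y‖ ^ 2 / 2) (b i) := fun i => by
    refine Integrable.of_bound (C := (2 * R) ^ 2 / 2) (by fun_prop) ?_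
    filter_upwards [hbC i] with y h
    rw [Real.norm_of_nonneg (by positivity)]
    have : ‖p i - y‖ ≤ 2 * R :=
      (norm_sub_le _ _).trans (by linarith [hX _ (hp i), hY _ (hCY i h)])
    gcongr
  have hlog : ∀ i, Real.log (u i) ≤ Real.log ((m i Set.univ).toReal) -
      ∫ y, ‖p i - y‖ ^ 2 / 2 ∂(b i) + 2 * R * d i := fun i => by
    have hMpos : 0 < (m i Set.univ).toReal := ENNReal.toReal_pos (hpos i) (measure_ne_top _ _)
    have h1 : ∫ y, Real.exp (-(‖p i - y‖ ^ 2 / 2)) ∂(b i) = ((m i Set.univ).toReal)⁻¹ * u i := by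
      rw [hb, integral_smul_measure, hum, ENNReal.toReal_inv, smul_eq_mul]
      simp only [neg_div]
    have h2 : 0 < ((m i Set.univ).toReal)⁻¹ * u i := mul_pos (inv_pos.2 hMpos) (hu i)
    have h3 := log_integral_exp_neg_le (hc i) (hbC i) (D := 2 * R * d i) (fun y hy y' hy' => by
      have h4 := sq_norm_sub_sub_sq_norm_sub_le (hY _ (hCY i hy)) (hY _ (hCY i hy')) (hX _ (hp i))
      rw [norm_sub_rev y, norm_sub_rev y'] at h4
      exact h4.trans (mul_le_mul_of_nonneg_left (hd i y hy y' hy') (by positivity)))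
      (h1 ▸ h2)
    rw [h1, Real.log_mul (inv_ne_zero hMpos.ne') (hu i).ne', Real.log_inv] at h3
    linarith
  have hent := (averagedMarginal_entropy_le hN hm hpos).2
  have hW := W2_average_le hR hX hY hμX hN hp hw hbprob hbY
  have hsum := mul_le_mul_of_nonneg_left
    (Finset.sum_le_sum fun i (_ : i ∈ Finset.univ) => hlog i) (one_div_pos.2 hNpos).le
  rw [Finset.sum_add_distrib, Finset.sum_sub_distrib, ← Finset.mul_sum, mul_add, mul_sub,
    mul_left_comm (1 / (N : ℝ))] at hsum
  rw [show (N : ENNReal)⁻¹ • ∑ i, b i = averagedMarginal m from rfl] at hW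
  linarith

end UpperBound

section StrongConcavity

theorem mul_log_ge {x : ℝ} (hx0 : 0 ≤ x) (hx2 : x ≤ 2) : x - 1 + (x - 1) ^ 2 / 6 ≤ x * Real.log x := by
  rcases hx0.eq_or_lt with rfl | hx
  · norm_num
  obtain ⟨r, hr, rfl⟩ : ∃ r : ℝ, 0 < r ∧ r ^ 2 = x := ⟨√x, Real.sqrt_pos.2 hx, Real.sq_sqrt hx0⟩
  have h1 : 1 - r⁻¹ ≤ Real.log r := Real.one_sub_inv_le_log_of_pos hr
  have h2 : r ^ 2 * (1 - r⁻¹) ≤ r ^ 2 * Real.log r := mul_le_mul_of_nonneg_left h1 hx0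
  have h3 : r ^ 2 * (1 - r⁻¹) = r ^ 2 - r := by field_simp
  rw [Real.log_pow]
  push_cast
  have h4 : (r + 1) ^ 2 ≤ 6 := by nlinarith [sq_nonneg (r - 1)]
  have h5 := mul_le_mul_of_nonneg_left h4 (sq_nonneg (r - 1))
  nlinarith

theorem mul_log_midpoint_le {a b l : ℝ} (ha : 0 ≤ a) (hb : 0 ≤ b) :
    (a + b) / 2 * Real.log ((a + b) / 2) + (l * |a - b| - 3 * l ^ 2 * ((a + b) / 2)) / 2 ≤
      (a * Real.log a + b * Real.log b) / 2 := by
  obtain ⟨m, hm⟩ : ∃ m, m = (a + b) / 2 := ⟨_, rfl⟩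
  rw [← hm]
  rcases (show 0 ≤ m by rw [hm]; positivity).eq_or_lt with h | h
  · have h1 : a = 0 := by linarith
    have h2 : b = 0 := by linarith
    simp [h1, h2, ← h]
  have key : ∀ c, 0 ≤ c → c ≤ 2 * m →
      c - m + (c - m) ^ 2 / (6 * m) + c * Real.log m ≤ c * Real.log c := fun c hc hc2 => by
    rcases hc.eq_or_lt with rfl | hc
    · have : 0 - m + (0 - m) ^ 2 / (6 * m) = -(5 / 6) * m := by field_simp; ring
      rw [this]; simp; linarith
    have h1 := mul_log_ge (x := c / m) (by positivity) (by rw [div_le_iff₀ h]; linarith)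
    rw [Real.log_div hc.ne' h.ne'] at h1
    have h2 := mul_le_mul_of_nonneg_left h1 h.le
    have e1 : m * (c / m - 1 + (c / m - 1) ^ 2 / 6) = c - m + (c - m) ^ 2 / (6 * m) := by
      field_simp
    have e2 : m * (c / m * (Real.log c - Real.log m)) = c * Real.log c - c * Real.log m := by
      field_simp
    rw [e1, e2] at h2
    linarith
  have ka := key a ha (by linarith)
  have kb := key b hb (by linarith)
  have hsq : l * |a - b| - 3 * l ^ 2 * m ≤ (a - b) ^ 2 / (12 * m) := by
    rw [le_div_iff₀ (by positivity), ← sq_abs (a - b)]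
    nlinarith [sq_nonneg (|a - b| - 6 * l * m)]
  have e3 : (a - m) ^ 2 / (6 * m) + (b - m) ^ 2 / (6 * m) = (a - b) ^ 2 / (12 * m) := by
    rw [show b = 2 * m - a by linarith]; field_simp; ring
  have e4 : a * Real.log m + b * Real.log m = 2 * (m * Real.log m) := by
    rw [← add_mul, hm]; ring
  linarith

theorem map_smul_add_midpoint {Ω Ω' : Type*} [MeasurableSpace Ω] [MeasurableSpace Ω']
    (γ₀ γ₁ : Measure Ω) {f : Ω → Ω'} (hf : Measurable f) :
    ((2 : ENNReal)⁻¹ • (γ₀ + γ₁)).map f = (2 : ENNReal)⁻¹ • (γ₀.map f + γ₁.map f) := by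
  rw [Measure.map_smul, Measure.map_add _ _ hf]

theorem isProbabilityMeasure_midpoint {Ω : Type*} [MeasurableSpace Ω] (γ₀ γ₁ : Measure Ω)
    [IsProbabilityMeasure γ₀] [IsProbabilityMeasure γ₁] :
    IsProbabilityMeasure ((2 : ENNReal)⁻¹ • (γ₀ + γ₁)) := ⟨by
  rw [Measure.smul_apply, Measure.add_apply, measure_univ, measure_univ, one_add_one_eq_two,
    smul_eq_mul, ENNReal.inv_mul_cancel two_ne_zero ENNReal.ofNat_ne_top]⟩

theorem W2_midpoint_le {n : ℕ} {X Y : Set (EuclideanSpace ℝ (Fin n))} {R : ℝ}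
    (hX : ∀ x ∈ X, ‖x‖ ≤ R) (hY : ∀ y ∈ Y, ‖y‖ ≤ R)
    {μ β₀ β₁ : Measure (EuclideanSpace ℝ (Fin n))} [IsProbabilityMeasure μ]
    [IsProbabilityMeasure β₀] [IsProbabilityMeasure β₁] (hμX : μ Xᶜ = 0) (hβ₀Y : β₀ Yᶜ = 0)
    (hβ₁Y : β₁ Yᶜ = 0) :
    W2 μ ((2 : ENNReal)⁻¹ • (β₀ + β₁)) ≤ (W2 μ β₀ + W2 μ β₁) / 2 := by
  refine le_of_forall_pos_le_add fun ε hε => ?_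
  have hint : ∀ {β : Measure (EuclideanSpace ℝ (Fin n))}
      {γ : Measure (EuclideanSpace ℝ (Fin n) × EuclideanSpace ℝ (Fin n))}, β Yᶜ = 0 →
      IsProbabilityMeasure γ → γ.map Prod.fst = μ → γ.map Prod.snd = β →
      Integrable (fun q => ‖q.1 - q.2‖ ^ 2 / 2) γ := fun {β γ} hβ h h1 h2 => by
    have hμX' : ∀ᵐ x ∂μ, x ∈ X := by rw [ae_iff]; exact hμX
    have hβY' : ∀ᵐ y ∂β, y ∈ Y := by rw [ae_iff]; exact hβ
    exact integrable_cost hX hY (ae_of_ae_map measurable_fst.aemeasurable (by rwa [h1]))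
      (ae_of_ae_map measurable_snd.aemeasurable (by rwa [h2]))
  obtain ⟨γ₀, h₀, h₀1, h₀2, h₀ε⟩ := exists_coupling_lt μ β₀ hε
  obtain ⟨γ₁, h₁, h₁1, h₁2, h₁ε⟩ := exists_coupling_lt μ β₁ hε
  have hcoup := W2_le_integral (isProbabilityMeasure_midpoint γ₀ γ₁) (μ := μ)
    (β := (2 : ENNReal)⁻¹ • (β₀ + β₁))
    (by rw [map_smul_add_midpoint _ _ measurable_fst, h₀1, h₁1, ← two_smul ENNReal μ, smul_smul,
      ENNReal.inv_mul_cancel two_ne_zero ENNReal.ofNat_ne_top, one_smul])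
    (by rw [map_smul_add_midpoint _ _ measurable_snd, h₀2, h₁2])
  rw [integral_smul_measure, integral_add_measure (hint hβ₀Y h₀ h₀1 h₀2) (hint hβ₁Y h₁ h₁1 h₁2),
    ENNReal.toReal_inv, ENNReal.toReal_ofNat, smul_eq_mul] at hcoup
  linarith

theorem entropy_midpoint_le {Y : Type*} [MeasurableSpace Y] {ν β₀ β₁ : Measure Y}
    [IsProbabilityMeasure ν] [IsProbabilityMeasure β₀] [IsProbabilityMeasure β₁]
    (h₀ : β₀ ≪ ν) (h₀int : Integrable (fun y => Real.log ((β₀.rnDeriv ν y).toReal)) β₀)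
    (h₁ : β₁ ≪ ν) (h₁int : Integrable (fun y => Real.log ((β₁.rnDeriv ν y).toReal)) β₁) :
    (2 : ENNReal)⁻¹ • (β₀ + β₁) ≪ ν ∧
    Integrable (fun y => Real.log ((((2 : ENNReal)⁻¹ • (β₀ + β₁)).rnDeriv ν y).toReal))
      ((2 : ENNReal)⁻¹ • (β₀ + β₁)) ∧
    ∫ y, Real.log ((((2 : ENNReal)⁻¹ • (β₀ + β₁)).rnDeriv ν y).toReal)
        ∂((2 : ENNReal)⁻¹ • (β₀ + β₁)) +
        (∫ y, |(β₀.rnDeriv ν y).toReal - (β₁.rnDeriv ν y).toReal| ∂ν) ^ 2 / 24 ≤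
      (∫ y, Real.log ((β₀.rnDeriv ν y).toReal) ∂β₀ +
        ∫ y, Real.log ((β₁.rnDeriv ν y).toReal) ∂β₁) / 2 := by
  have hprob := isProbabilityMeasure_midpoint β₀ β₁
  set β := (2 : ENNReal)⁻¹ • (β₀ + β₁) with hβ
  have hac : β ≪ ν := (Measure.AbsolutelyContinuous.add_left h₀ h₁).smul_left _
  set f : Y → ℝ := fun y => (β₀.rnDeriv ν y).toReal with hf
  set g : Y → ℝ := fun y => (β₁.rnDeriv ν y).toReal with hg
  have hfm : Measurable f := (Measure.measurable_rnDeriv _ _).ennreal_toReal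
  have hgm : Measurable g := (Measure.measurable_rnDeriv _ _).ennreal_toReal
  have hf0 : ∀ y, 0 ≤ f y := fun y => ENNReal.toReal_nonneg
  have hg0 : ∀ y, 0 ≤ g y := fun y => ENNReal.toReal_nonneg
  have hfi : Integrable f ν := Measure.integrable_toReal_rnDeriv
  have hgi : Integrable g ν := Measure.integrable_toReal_rnDeriv
  have hfI : ∫ y, f y ∂ν = 1 := by
    rw [hf, Measure.integral_toReal_rnDeriv h₀, probReal_univ]
  have hgI : ∫ y, g y ∂ν = 1 := by
    rw [hg, Measure.integral_toReal_rnDeriv h₁, probReal_univ]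
  have hρ : ∀ᵐ y ∂ν, (β.rnDeriv ν y).toReal = (f y + g y) / 2 := by
    have e1 := Measure.rnDeriv_smul_left_of_ne_top (β₀ + β₁) ν (r := (2 : ENNReal)⁻¹) (by simp)
    filter_upwards [e1, Measure.rnDeriv_add β₀ β₁ ν, Measure.rnDeriv_lt_top β₀ ν,
      Measure.rnDeriv_lt_top β₁ ν] with y h1 h2 h3 h4
    rw [hβ, h1, Pi.smul_apply, h2, Pi.add_apply, smul_eq_mul, ENNReal.toReal_mul,
      ENNReal.toReal_add h3.ne h4.ne, ENNReal.toReal_inv, ENNReal.toReal_ofNat]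
    ring
  have hfl : Integrable (fun y => f y * Real.log (f y)) ν :=
    (integrable_rnDeriv_smul_iff h₀).2 h₀int
  have hgl : Integrable (fun y => g y * Real.log (g y)) ν :=
    (integrable_rnDeriv_smul_iff h₁).2 h₁int
  have hml : Integrable (fun y => (f y + g y) / 2 * Real.log ((f y + g y) / 2)) ν := by
    have hm : Measurable fun y => (f y + g y) / 2 := (hfm.add hgm).div_const 2
    refine integrable_of_le_of_le (hm.mul (Real.measurable_log.comp hm)).aestronglyMeasurable
      (g₁ := fun _ => -1) (g₂ := fun y => (f y * Real.log (f y) + g y * Real.log (g y)) / 2)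
      (.of_forall fun y => ?_) (.of_forall fun y => ?_) (integrable_const _)
      ((hfl.add hgl).div_const 2)
    · have h0 : 0 ≤ (f y + g y) / 2 := by linarith [hf0 y, hg0 y]
      rcases h0.eq_or_lt with h | h
      · dsimp only; rw [← h]; norm_num
      · have h1 := mul_le_mul_of_nonneg_left (Real.one_sub_inv_le_log_of_pos h) h0
        rw [mul_sub, mul_inv_cancel₀ h.ne'] at h1
        linarith
    · have := mul_log_midpoint_le (l := 0) (hf0 y) (hg0 y)
      simpa using this
  have hmρ : (fun y => (β.rnDeriv ν y).toReal • Real.log ((β.rnDeriv ν y).toReal)) =ᵐ[ν]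
      fun y => (f y + g y) / 2 * Real.log ((f y + g y) / 2) := by
    filter_upwards [hρ] with y h
    rw [h, smul_eq_mul]
  refine ⟨hac, (integrable_rnDeriv_smul_iff hac).1 (hml.congr hmρ.symm), ?_⟩
  have hd : Integrable (fun y => |f y - g y|) ν := (hfi.sub hgi).abs
  set I := ∫ y, |f y - g y| ∂ν with hI
  have hma : Integrable (fun y => 3 * (I / 6) ^ 2 * ((f y + g y) / 2)) ν :=
    ((hfi.add hgi).div_const 2).const_mul _
  have hcorr : Integrable (fun y => (I / 6 * |f y - g y| - 3 * (I / 6) ^ 2 * ((f y + g y) / 2)) / 2)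
      ν := ((hd.const_mul _).sub hma).div_const 2
  have key : ∫ y, ((f y + g y) / 2 * Real.log ((f y + g y) / 2) +
      (I / 6 * |f y - g y| - 3 * (I / 6) ^ 2 * ((f y + g y) / 2)) / 2) ∂ν ≤
      ∫ y, (f y * Real.log (f y) + g y * Real.log (g y)) / 2 ∂ν :=
    integral_mono (hml.add hcorr) ((hfl.add hgl).div_const 2)
      fun y => mul_log_midpoint_le (hf0 y) (hg0 y)
  rw [integral_add hml hcorr, integral_div, integral_sub (hd.const_mul _) hma,
    integral_const_mul, integral_const_mul, integral_div, integral_add hfi hgi, hfI, hgI,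
    integral_div, integral_add hfl hgl, ← hI] at key
  rw [← integral_rnDeriv_smul hac, ← integral_rnDeriv_smul h₀, ← integral_rnDeriv_smul h₁,
    integral_congr_ae hmρ]
  simp only [smul_eq_mul]
  linarith

end StrongConcavity

section Stability

variable {n : ℕ}

theorem Fhat_of_integrable {μ ν β : Measure (EuclideanSpace ℝ (Fin n))} (h : β ≪ ν)
    (hint : Integrable (fun y => Real.log ((β.rnDeriv ν y).toReal)) β) :
    Fhat μ ν β =
      ((-(∫ y, Real.log ((β.rnDeriv ν y).toReal) ∂β) - W2 μ β : ℝ) : EReal) :=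
  if_pos ⟨h, hint⟩

theorem integrable_log_rnDeriv_self {Y : Type*} [MeasurableSpace Y] (ν : Measure Y)
    [IsProbabilityMeasure ν] : Integrable (fun y => Real.log ((ν.rnDeriv ν y).toReal)) ν := by
  refine (integrable_zero Y ℝ ν).congr ?_
  filter_upwards [Measure.rnDeriv_self ν] with y h
  simp [h]

theorem ac_and_integrable_of_Fhat_ge {μ ν β : Measure (EuclideanSpace ℝ (Fin n))}
    [IsProbabilityMeasure ν] (h : Fhat μ ν ν ≤ Fhat μ ν β) :
    β ≪ ν ∧ Integrable (fun y => Real.log ((β.rnDeriv ν y).toReal)) β := by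
  by_contra hcon
  rw [Fhat_of_integrable Measure.AbsolutelyContinuous.rfl (integrable_log_rnDeriv_self ν),
    show Fhat μ ν β = ⊥ from if_neg hcon, le_bot_iff] at h
  exact EReal.coe_ne_bot _ h

theorem abs_integral_sub_le_of_ac {Y : Type*} [MeasurableSpace Y] {ν β₀ β₁ : Measure Y}
    [IsProbabilityMeasure ν] [IsProbabilityMeasure β₀] [IsProbabilityMeasure β₁]
    (h₀ : β₀ ≪ ν) (h₁ : β₁ ≪ ν) {f : Y → ℝ} (hf : Measurable f) {K : ℝ} (hfK : ∀ y, |f y| ≤ K) :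
    |∫ y, f y ∂β₀ - ∫ y, f y ∂β₁| ≤
      K * ∫ y, |(β₀.rnDeriv ν y).toReal - (β₁.rnDeriv ν y).toReal| ∂ν := by
  have hi : ∀ β : Measure Y, IsProbabilityMeasure β → Integrable f β := fun β _ =>
    Integrable.of_bound hf.aestronglyMeasurable K (.of_forall hfK)
  have i₀ := (integrable_rnDeriv_smul_iff h₀).2 (hi β₀ inferInstance)
  have i₁ := (integrable_rnDeriv_smul_iff h₁).2 (hi β₁ inferInstance)
  rw [← integral_rnDeriv_smul h₀, ← integral_rnDeriv_smul h₁, ← integral_sub i₀ i₁,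
    ← integral_const_mul]
  refine abs_integral_le_integral_abs.trans (integral_mono (i₀.sub i₁).abs
    ((Measure.integrable_toReal_rnDeriv.sub Measure.integrable_toReal_rnDeriv).abs.const_mul K)
    fun y => ?_)
  dsimp only
  rw [← sub_smul, smul_eq_mul, abs_mul, mul_comm]
  exact mul_le_mul_of_nonneg_right (hfK y) (abs_nonneg _)

/-- Competitors whose value is almost maximal are close to the maximizer in total variation. -/
theorem sq_integral_abs_sub_rnDeriv_le {X Y : Set (EuclideanSpace ℝ (Fin n))} {R : ℝ}
    (hX : ∀ x ∈ X, ‖x‖ ≤ R) (hY : ∀ y ∈ Y, ‖y‖ ≤ R)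
    {μ ν β₀ β₁ : Measure (EuclideanSpace ℝ (Fin n))} [IsProbabilityMeasure μ]
    [IsProbabilityMeasure ν] [IsProbabilityMeasure β₀] [IsProbabilityMeasure β₁]
    (hμX : μ Xᶜ = 0) (hβ₀Y : β₀ Yᶜ = 0) (hβ₁Y : β₁ Yᶜ = 0)
    (h₀ : β₀ ≪ ν) (h₀int : Integrable (fun y => Real.log ((β₀.rnDeriv ν y).toReal)) β₀)
    (h₁ : β₁ ≪ ν) (h₁int : Integrable (fun y => Real.log ((β₁.rnDeriv ν y).toReal)) β₁)
    (hmax : ∀ β : Measure (EuclideanSpace ℝ (Fin n)), IsProbabilityMeasure β →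
      β Yᶜ = 0 → Fhat μ ν β ≤ Fhat μ ν β₁) :
    (∫ y, |(β₀.rnDeriv ν y).toReal - (β₁.rnDeriv ν y).toReal| ∂ν) ^ 2 ≤
      12 * ((-(∫ y, Real.log ((β₁.rnDeriv ν y).toReal) ∂β₁) - W2 μ β₁) -
        (-(∫ y, Real.log ((β₀.rnDeriv ν y).toReal) ∂β₀) - W2 μ β₀)) := by
  obtain ⟨hac, hint, hent⟩ := entropy_midpoint_le h₀ h₀int h₁ h₁int
  have hW := W2_midpoint_le hX hY hμX hβ₀Y hβ₁Y
  have h := hmax _ (isProbabilityMeasure_midpoint β₀ β₁) (by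
    rw [Measure.smul_apply, Measure.add_apply, hβ₀Y, hβ₁Y]; simp)
  rw [Fhat_of_integrable hac hint, Fhat_of_integrable h₁ h₁int, EReal.coe_le_coe_iff] at h
  linarith

end Stability

section Convergence

open scoped RealInnerProductSpace

variable {n : ℕ}

/-- A Nash maximizer is almost optimal for the continuum problem. -/
theorem Fhat_averagedMarginal_ge {X Y : Set (EuclideanSpace ℝ (Fin n))} {R : ℝ} (hR : 0 ≤ R)
    (hX : ∀ x ∈ X, ‖x‖ ≤ R) (hYne : Y.Nonempty) (hY : ∀ y ∈ Y, ‖y‖ ≤ R)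
    {μ ν β : Measure (EuclideanSpace ℝ (Fin n))} [IsProbabilityMeasure μ]
    [IsProbabilityMeasure ν] [IsProbabilityMeasure β] (hμX : μ Xᶜ = 0) (hνY : ν Yᶜ = 0)
    (hβY : β Yᶜ = 0) (hβν : β ≪ ν)
    (hent : Integrable (fun y => Real.log ((β.rnDeriv ν y).toReal)) β)
    {t ε : ℝ} (ht : 0 < t)
    (htrans : ∀ (k : Fin n) (g : EuclideanSpace ℝ (Fin n) → ℝ) (C : ℝ), Measurable g →
      (∀ x, |g x| ≤ C) →
      |∫ x, g x ∂μ - ∫ x, g (x - t • EuclideanSpace.single k 1) ∂μ| ≤ C * ε)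
    {N : ℕ} (hN : 1 ≤ N) {p : Fin N → EuclideanSpace ℝ (Fin n)} (hp : ∀ i, p i ∈ X) {δ : ℝ}
    {w : Fin N → EuclideanSpace ℝ (Fin n) → ℝ} (hw : IsTransportWeights μ p δ w)
    {m : Fin N → Measure (EuclideanSpace ℝ (Fin n))} (hm : ∑ i, m i = ν)
    {u : Fin N → ℝ} (hum : ∀ i, u i = ∫ y, Real.exp (-‖p i - y‖ ^ 2 / 2) ∂(m i))
    (hu : ∀ i, 0 < u i) {v : EuclideanSpace ℝ (Fin n) → ℝ} (hvm : Measurable v)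
    (hle : ∀ i y, Real.exp (-‖p i - y‖ ^ 2 / 2) ≤ u i * v y)
    (heq : ∀ y, ∃ i, Real.exp (-‖p i - y‖ ^ 2 / 2) = u i * v y)
    (hae : ∀ i, ∀ᵐ y ∂(m i), Real.exp (-‖p i - y‖ ^ 2 / 2) = u i * v y)
    (hvN : ∫ y, v y ∂ν = N) :
    -(∫ y, Real.log ((β.rnDeriv ν y).toReal) ∂β) - W2 μ β ≤
      -(∫ y, Real.log (((averagedMarginal m).rnDeriv ν y).toReal) ∂(averagedMarginal m)) -
        W2 μ (averagedMarginal m) + (4 * R * δ + 2 * R * (n * (R * ε + 4 * R * δ / t))) := by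
  have hv : ∀ y, 0 < v y := fun y =>
    pos_of_mul_pos_right ((Real.exp_pos _).trans_le (hle ⟨0, hN⟩ y)) (hu _).le
  have hsq : ∀ i y, -‖p i - y‖ ^ 2 / 2 = ⟪p i, y⟫ - ‖p i‖ ^ 2 / 2 - ‖y‖ ^ 2 / 2 := fun i y => by
    rw [norm_sub_sq_real]; ring
  have hlog : ∀ i y, Real.log (u i * v y) = Real.log (u i) + Real.log (v y) := fun i y =>
    Real.log_mul (hu i).ne' (hv y).ne'
  obtain ⟨d, hd, hdsum⟩ := exists_cell_diameter_bound hX hYne hY hμX ht htrans hN hp hw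
    (fun y => ‖y‖ ^ 2 / 2 + Real.log (v y)) (fun i => ‖p i‖ ^ 2 / 2 + Real.log (u i))
    (fun i => {y | y ∈ Y ∧ Real.exp (-‖p i - y‖ ^ 2 / 2) = u i * v y}) (fun i y hy => hy.1)
    (fun i y _ => by
      have h := (Real.le_log_iff_exp_le (mul_pos (hu i) (hv y))).2 (hle i y)
      rw [hlog, hsq] at h
      linarith)
    (fun i y hy => by
      have h := congrArg Real.log hy.2
      rw [Real.log_exp, hlog, hsq] at h
      linarith)
  have hlow := le_nash_value hR hX hY hμX hβY hβν hent hN hp hw hu hvm hle heq hvN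
  have hmY : ∀ i, ∀ᵐ y ∂(m i), y ∈ Y := fun i => by
    have h : m i ≤ ν := by
      rw [← hm]
      exact Finset.single_le_sum (f := m) (fun _ _ => Measure.zero_le _) (Finset.mem_univ i)
    rw [ae_iff]
    exact nonpos_iff_eq_zero.1 ((h Yᶜ).trans hνY.le)
  have hup := nash_value_le hR hX hY hμX hνY hN hp hw hm hum hu (fun i y hy => hy.1)
    (fun i => (hmY i).and (hae i)) hd
  have h3 := mul_le_mul_of_nonneg_left hdsum (show 0 ≤ 2 * R by positivity)
  linarith

theorem exists_translation_step {μ : Measure (EuclideanSpace ℝ (Fin n))} [IsFiniteMeasure μ]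
    (hμ : μ ≪ volume) {ε : ℝ} (hε : 0 < ε) :
    ∃ t : ℝ, 0 < t ∧ ∀ (k : Fin n) (g : EuclideanSpace ℝ (Fin n) → ℝ) (C : ℝ), Measurable g →
      (∀ x, |g x| ≤ C) →
      |∫ x, g x ∂μ - ∫ x, g (x - t • EuclideanSpace.single k 1) ∂μ| ≤ C * ε := by
  have h := eventually_abs_integral_sub_translate_le μ hμ hε
  have hk : ∀ k : Fin n, Filter.Tendsto
      (fun t : ℝ => t • (EuclideanSpace.single k 1 : EuclideanSpace ℝ (Fin n)))
      (nhdsWithin 0 (Set.Ioi 0)) (nhds 0) := fun k => by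
    have hc : Continuous fun t : ℝ =>
        t • (EuclideanSpace.single k 1 : EuclideanSpace ℝ (Fin n)) := by fun_prop
    have := hc.tendsto 0
    rw [zero_smul] at this
    exact this.mono_left nhdsWithin_le_nhds
  obtain ⟨t, ht, ht0⟩ := ((Filter.eventually_all.2 fun k => (hk k).eventually h).and
    self_mem_nhdsWithin).exists
  exact ⟨t, ht0, ht⟩

end Convergence

/-- convergence of finite-player Nash bargaining solutions to the continuum
solution: the averaged right marginals `β_N` of the finite Nash maximizers satisfy
`F̂(β_N) → F̂(β̂)` and `β_N → β̂` weakly, where `β̂` is the unique maximizer of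
`F̂(β) = −H_ν(β) − W²(μ, β)`. -/
theorem finite_nash_solutions_converge
    {n : ℕ} (X Y : Set (EuclideanSpace ℝ (Fin n)))
    (hXc : IsCompact X) (hXconv : Convex ℝ X) (hXint : (interior X).Nonempty)
    (hYc : IsCompact Y) (hYconv : Convex ℝ Y) (hYint : (interior Y).Nonempty)
    (μ : Measure (EuclideanSpace ℝ (Fin n))) [IsProbabilityMeasure μ]
    (hμX : μ Xᶜ = 0) (hμac : μ ≪ volume)
    (a₁ a₂ : ℝ) (ha₁ : 0 < a₁)
    (hμdens : ∀ᵐ x ∂(volume.restrict X),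
      ENNReal.ofReal a₁ ≤ μ.rnDeriv volume x ∧ μ.rnDeriv volume x ≤ ENNReal.ofReal a₂)
    (ν : Measure (EuclideanSpace ℝ (Fin n))) [IsProbabilityMeasure ν]
    (hνY : ν Yᶜ = 0) (hνac : ν ≪ volume)
    (b₁ b₂ : ℝ) (hb₁ : 0 < b₁)
    (hνdens : ∀ᵐ y ∂(volume.restrict Y),
      ENNReal.ofReal b₁ ≤ ν.rnDeriv volume y ∧ ν.rnDeriv volume y ≤ ENNReal.ofReal b₂)
    -- the chosen points and the empirical measures
    (p : (N : ℕ) → Fin N → EuclideanSpace ℝ (Fin n)) (hpX : ∀ N i, p N i ∈ X)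
    (μ' : ℕ → Measure (EuclideanSpace ℝ (Fin n)))
    (hμ' : ∀ N, μ' N = (N : ENNReal)⁻¹ • ∑ i : Fin N, Measure.dirac (p N i))
    (hμ'weak : ∀ f : BoundedContinuousFunction (EuclideanSpace ℝ (Fin n)) ℝ,
      Filter.Tendsto (fun N => ∫ x, f x ∂(μ' N)) Filter.atTop (nhds (∫ x, f x ∂μ)))
    -- the utility densities `s(x,y) = exp(−|x−y|²/2)`
    (s : (N : ℕ) → Fin N → EuclideanSpace ℝ (Fin n) → ℝ)
    (hs : ∀ N i y, s N i y = Real.exp (-‖p N i - y‖ ^ 2 / 2))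
    -- the finite-player Nash maximizers
    (π : (N : ℕ) → Measure (Fin N × EuclideanSpace ℝ (Fin n)))
    (hπprob : ∀ N, 1 ≤ N → IsProbabilityMeasure (π N))
    (hπmarg : ∀ N, 1 ≤ N → (π N).map Prod.snd = ν)
    (hπmax : ∀ N, 1 ≤ N → ∀ π' : Measure (Fin N × EuclideanSpace ℝ (Fin n)),
      IsProbabilityMeasure π' → π'.map Prod.snd = ν → NashF (s N) π' ≤ NashF (s N) (π N))
    -- the averaged right marginals `β_N(Z) = (1/N) ∑ᵢ π_N({pᵢ}×Z)/π_N({pᵢ}×Y)`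
    (β' : ℕ → Measure (EuclideanSpace ℝ (Fin n)))
    (hβ' : ∀ N, β' N =
      (N : ENNReal)⁻¹ • ∑ i : Fin N, (π N ({i} ×ˢ (Set.univ : Set (EuclideanSpace ℝ (Fin n)))))⁻¹ • nuI (π N) i)
    -- the continuum maximizer
    (βhat : Measure (EuclideanSpace ℝ (Fin n))) [IsProbabilityMeasure βhat]
    (hβhatY : βhat Yᶜ = 0)
    (hβhatmax : ∀ β : Measure (EuclideanSpace ℝ (Fin n)), IsProbabilityMeasure β →
      β Yᶜ = 0 → Fhat μ ν β ≤ Fhat μ ν βhat) :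
    Filter.Tendsto (fun N => Fhat μ ν (β' N)) Filter.atTop (nhds (Fhat μ ν βhat)) ∧
    ∀ f : BoundedContinuousFunction (EuclideanSpace ℝ (Fin n)) ℝ,
      Filter.Tendsto (fun N => ∫ y, f y ∂(β' N)) Filter.atTop (nhds (∫ y, f y ∂βhat)) := by
  obtain ⟨RX, hRX⟩ := hXc.isBounded.exists_norm_le
  obtain ⟨RY, hRY⟩ := hYc.isBounded.exists_norm_le
  have hYne : Y.Nonempty := hYint.mono interior_subset
  obtain ⟨R, hR, hX, hY⟩ : ∃ R : ℝ, 0 ≤ R ∧ (∀ x ∈ X, ‖x‖ ≤ R) ∧ ∀ y ∈ Y, ‖y‖ ≤ R :=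
    ⟨max RX RY, (norm_nonneg _).trans ((hRY _ hYne.some_mem).trans (le_max_right _ _)),
      fun x hx => (hRX x hx).trans (le_max_left _ _),
      fun y hy => (hRY y hy).trans (le_max_right _ _)⟩
  have hp : ∀ f : BoundedContinuousFunction (EuclideanSpace ℝ (Fin n)) ℝ,
      Filter.Tendsto (fun N : ℕ => (1 / (N : ℝ)) * ∑ i, f (p N i)) Filter.atTop
        (nhds (∫ x, f x ∂μ)) := fun f => by
    refine (hμ'weak f).congr fun N => ?_
    rw [hμ', integral_smul_measure, integral_finsetSum_measure fun i _ => f.integrable _]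
    simp
  obtain ⟨hac, hint⟩ := ac_and_integrable_of_Fhat_ge (hβhatmax ν inferInstance hνY)
  obtain rfl : s = fun N i y => Real.exp (-‖p N i - y‖ ^ 2 / 2) := by
    funext N i y; exact hs N i y
  have hβ'avg : ∀ N, β' N = averagedMarginal fun i => nuI (π N) i := fun N => by
    simp only [hβ', averagedMarginal, nuI_univ]
  have hmsum : ∀ N, 1 ≤ N → ∑ i, nuI (π N) i = ν := fun N hN => (sum_nuI _).trans (hπmarg N hN)
  have hprice := fun N hN => exists_price hN ν _
    (fun i => by fun_prop) (fun i y => Real.exp_pos _)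
    (fun i y => Real.exp_le_one_iff.2 (by linarith [sq_nonneg ‖p N i - y‖]))
    (π N) (hπmarg N hN) (hπmax N hN)
  have hmpos : ∀ N, 1 ≤ N → ∀ i, nuI (π N) i Set.univ ≠ 0 := fun N hN i h => by
    obtain ⟨u, hu, hupos, -⟩ := hprice N hN
    have h1 := hupos i
    rw [hu, Measure.measure_univ_eq_zero.1 h, integral_zero_measure] at h1
    exact h1.false
  have hβ'ac : ∀ N, 1 ≤ N → β' N ≪ ν := fun N hN => by
    rw [hβ'avg]; exact averagedMarginal_absolutelyContinuous (hmsum N hN)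
  have hβ'int : ∀ N, 1 ≤ N →
      Integrable (fun y => Real.log (((β' N).rnDeriv ν y).toReal)) (β' N) := fun N hN => by
    rw [hβ'avg]; exact (averagedMarginal_entropy_le hN (hmsum N hN) (hmpos N hN)).1
  have hβ'prob : ∀ N, 1 ≤ N → IsProbabilityMeasure (β' N) := fun N hN => by
    have := hπprob N hN
    have : ∀ i, IsFiniteMeasure (nuI (π N) i) := fun i => ⟨by
      rw [nuI_univ]; exact measure_lt_top _ _⟩
    rw [hβ'avg]; exact isProbabilityMeasure_averagedMarginal hN (hmpos N hN)
  have hβ'Y : ∀ N, 1 ≤ N → β' N Yᶜ = 0 := fun N hN => hβ'ac N hN hνY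
  set r : ℕ → ℝ := fun N =>
    -(∫ y, Real.log (((β' N).rnDeriv ν y).toReal) ∂(β' N)) - W2 μ (β' N) with hr
  set rhat : ℝ := -(∫ y, Real.log ((βhat.rnDeriv ν y).toReal) ∂βhat) - W2 μ βhat with hrhat
  have hFN : ∀ N, 1 ≤ N → Fhat μ ν (β' N) = ((r N : ℝ) : EReal) := fun N hN =>
    Fhat_of_integrable (hβ'ac N hN) (hβ'int N hN)
  have hFhat : Fhat μ ν βhat = ((rhat : ℝ) : EReal) := Fhat_of_integrable hac hint
  have hupper : ∀ N, 1 ≤ N → r N ≤ rhat := fun N hN => by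
    have := hβhatmax _ (hβ'prob N hN) (hβ'Y N hN)
    rwa [hFN N hN, hFhat, EReal.coe_le_coe_iff] at this
  have hlower : ∀ ε : ℝ, 0 < ε → ∀ᶠ N in Filter.atTop, rhat ≤ r N + ε := fun ε hε => by
    obtain ⟨t, ht, htrans⟩ := exists_translation_step hμac
      (show 0 < ε / (4 * (R * n * R + 1)) by positivity)
    filter_upwards [exists_transport_weights hXc μ hμX p hpX hp
      (show 0 < ε / (2 * (4 * R + 8 * R * n * R / t + 1)) by positivity),
      Filter.eventually_ge_atTop 1] with N hw hN
    obtain ⟨w, hw⟩ := hw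
    obtain ⟨u, hu, hupos, v, hvm, hle, heq, hae, hvN⟩ := hprice N hN
    have h := Fhat_averagedMarginal_ge hR hX hYne hY hμX hνY hβhatY hac hint ht htrans hN (hpX N)
      hw (hmsum N hN) hu hupos hvm hle heq hae hvN
    rw [← hβ'avg] at h
    refine h.trans (add_le_add_right ?_ _)
    set ε₁ := ε / (4 * (R * n * R + 1)) with hε₁
    set δ := ε / (2 * (4 * R + 8 * R * n * R / t + 1)) with hδ
    have hε₁0 : 0 < ε₁ := by positivity
    have hδ0 : 0 < δ := by positivity
    have e1 : ε₁ * (4 * (R * n * R + 1)) = ε := div_mul_cancel₀ _ (by positivity)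
    have e2 : δ * (2 * (4 * R + 8 * R * n * R / t + 1)) = ε := div_mul_cancel₀ _ (by positivity)
    have e3 : 4 * R * δ + 2 * R * (n * (R * ε₁ + 4 * R * δ / t)) =
        (δ * (2 * (4 * R + 8 * R * n * R / t + 1)) - 2 * δ) / 2 +
          (ε₁ * (4 * (R * n * R + 1)) - 4 * ε₁) / 2 := by ring
    rw [e3, e1, e2]
    linarith
  have hrlim : Filter.Tendsto r Filter.atTop (nhds rhat) := by
    refine tendsto_order.2 ⟨fun a ha => ?_, fun a ha => ?_⟩
    · filter_upwards [hlower ((rhat - a) / 2) (by linarith)] with N hN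
      linarith
    · filter_upwards [Filter.eventually_ge_atTop 1] with N hN
      exact (hupper N hN).trans_lt ha
  refine ⟨?_, fun f => ?_⟩
  · rw [hFhat]
    refine ((continuous_coe_real_ereal.tendsto rhat).comp hrlim).congr' ?_
    filter_upwards [Filter.eventually_ge_atTop 1] with N hN
    exact (hFN N hN).symm
  · have hlim : Filter.Tendsto (fun N => ‖f‖ * √(12 * (rhat - r N))) Filter.atTop (nhds 0) := by
      have h1 := (Real.continuous_sqrt.tendsto _).comp
        ((tendsto_const_nhds (x := rhat)).sub hrlim |>.const_mul 12)
      rw [sub_self, mul_zero, Real.sqrt_zero] at h1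
      simpa using h1.const_mul ‖f‖
    rw [tendsto_iff_dist_tendsto_zero]
    refine squeeze_zero' (.of_forall fun N => dist_nonneg) ?_ hlim
    filter_upwards [Filter.eventually_ge_atTop 1] with N hN
    have := hβ'prob N hN
    rw [Real.dist_eq]
    refine (abs_integral_sub_le_of_ac (hβ'ac N hN) hac f.continuous.measurable
      fun y => f.norm_coe_le_norm y).trans ?_
    gcongr
    exact Real.le_sqrt_of_sq_le (sq_integral_abs_sub_rnDeriv_le hX hY hμX (hβ'Y N hN) hβhatY
      (hβ'ac N hN) (hβ'int N hN) hac hint hβhatmax)
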